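/- arXiv:math/0612061 — 8 statements merged into one kernel-verified Lean document; each statement's English description precedes it below -/
import Mathlib

section
/- Let n be an even positive integer. The convex hull in ℝ^{n−1} of all realizable dual degree partitions on n vertices equals the polytope {x ∈ ℝ^{n−1} : n ≥ x_1 ≥ x_2 ≥ … ≥ x_{n−1} ≥ 0}. -/
/-- The degree of a vertex `v` in a simple graph `G` on `Fin n`. -/
noncomputable def deg {n : ℕ} (G : SimpleGraph (Fin n)) (v : Fin n) : ℕ :=
  Set.ncard {w | G.Adj v w}

/-- The dual degree partition of a graph `G` on `n` vertices, regarded as a point of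
`ℝ^{n-1}`: the `j`-th coordinate (0-indexed) is `d*_{j+1} = #{v : deg v ≥ j+1}`. -/
noncomputable def ddp (n : ℕ) (G : SimpleGraph (Fin n)) : Fin (n - 1) → ℝ :=
  fun j => (Set.ncard {v : Fin n | (j : ℕ) + 1 ≤ deg G v} : ℝ)

/-- `x ∈ ℝ^{n-1}` is a realizable dual degree partition on `n` vertices. -/
def IsRealizableDDP (n : ℕ) (x : Fin (n - 1) → ℝ) : Prop :=
  ∃ G : SimpleGraph (Fin n), x = ddp n G

/-- The point `a^(k) = (n,…,n,0,…,0)` with `k` entries `n` followed by `n-1-k` zeros. -/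
noncomputable def aPoint (n k : ℕ) : Fin (n - 1) → ℝ :=
  fun j => if (j : ℕ) < k then (n : ℝ) else 0

/-- The point `b^(k,l)`: `2k` entries `n`, then `2l+1` entries `n-1`, then zeros. -/
noncomputable def bPoint (n k l : ℕ) : Fin (n - 1) → ℝ :=
  fun j => if (j : ℕ) < 2 * k then (n : ℝ)
           else if (j : ℕ) < 2 * k + 2 * l + 1 then (n : ℝ) - 1 else 0

/-- The point `c^(k,l)`: `2k+1` entries `n`, then `2l+1` entries `1`, then zeros. -/
noncomputable def cPoint (n k l : ℕ) : Fin (n - 1) → ℝ :=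
  fun j => if (j : ℕ) < 2 * k + 1 then (n : ℝ)
           else if (j : ℕ) < 2 * k + 2 * l + 2 then 1 else 0

/-- The polytope `{x ∈ ℝ^{n-1} : n ≥ x_1 ≥ x_2 ≥ ⋯ ≥ x_{n-1} ≥ 0}`. -/
def Rpoly (n : ℕ) : Set (Fin (n - 1) → ℝ) :=
  {x | (∀ i, x i ≤ n) ∧ (∀ i, 0 ≤ x i) ∧ ∀ i j : Fin (n - 1), i ≤ j → x j ≤ x i}

/-- The alternating sum `(x_1 - x_2) + (x_3 - x_4) + ⋯ + (x_{n-2} - x_{n-1})`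
(for odd `n`; in 0-indexed form the pairs are `(0,1), (2,3), …, (n-3,n-2)`). -/
noncomputable def altSum (n : ℕ) (x : Fin (n - 1) → ℝ) : ℝ :=
  ∑ i ∈ Finset.range ((n - 1) / 2),
    ((if h : 2 * i < n - 1 then x ⟨2 * i, h⟩ else 0) -
     (if h : 2 * i + 1 < n - 1 then x ⟨2 * i + 1, h⟩ else 0))


/-- The sum graph: `v ~ w` iff `(v + w) mod n` is odd and smaller than `2k`. -/
def sumGraph (n k : ℕ) (heven : Even n) : SimpleGraph (Fin n) where
  Adj v w := ((v : ℕ) + w) % n % 2 = 1 ∧ ((v : ℕ) + w) % n < 2 * k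
  symm := ⟨by
    intro v w h
    rwa [add_comm (w : ℕ) v]⟩
  loopless := ⟨by
    rintro v ⟨h, -⟩
    rw [Nat.mod_mod_of_dvd _ heven.two_dvd] at h
    omega⟩

lemma card_odd (n k : ℕ) (h : 2 * k ≤ n) :
    Set.ncard {u : Fin n | (u : ℕ) % 2 = 1 ∧ (u : ℕ) < 2 * k} = k := by
  have : {u : Fin n | (u : ℕ) % 2 = 1 ∧ (u : ℕ) < 2 * k} =
      Set.range (fun i : Fin k => (⟨2 * i + 1, by omega⟩ : Fin n)) := by
    ext u
    simp only [Set.mem_setOf_eq, Set.mem_range, Fin.ext_iff]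
    constructor
    · rintro ⟨h1, h2⟩
      exact ⟨⟨(u : ℕ) / 2, by omega⟩, by simp; omega⟩
    · rintro ⟨i, hi⟩
      omega
  rw [this, ← Set.image_univ, Set.ncard_image_of_injective]
  · simp
  · intro a b hab
    simp only [Fin.ext_iff] at hab ⊢
    omega

lemma deg_sumGraph (n k : ℕ) (heven : Even n) (h : 2 * k ≤ n) (v : Fin n) :
    deg (sumGraph n k heven) v = k := by
  have : NeZero n := ⟨by have := v.2; omega⟩
  unfold deg
  conv_rhs => rw [← card_odd n k h]
  rw [← Set.ncard_image_of_injective _ (add_right_injective v)]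
  congr 1
  ext u
  simp only [Set.mem_image, Set.mem_setOf_eq, sumGraph]
  constructor
  · rintro ⟨w, hw, rfl⟩
    simpa [Fin.val_add] using hw
  · intro hu
    refine ⟨u - v, ?_, by simp⟩
    have h2 : ((v : ℕ) + ((u - v : Fin n) : ℕ)) % n = u := by
      rw [← Fin.val_add]; simp
    rw [h2]; exact hu

lemma deg_compl {n : ℕ} (G : SimpleGraph (Fin n)) (v : Fin n) :
    deg Gᶜ v = n - 1 - deg G v := by
  classical
  have h (H : SimpleGraph (Fin n)) : deg H v = H.degree v := by
    unfold deg
    rw [← SimpleGraph.card_neighborSet_eq_degree, ← Nat.card_eq_fintype_card]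
    rfl
  rw [h, h, SimpleGraph.degree_compl]
  simp

lemma exists_regular (n k : ℕ) (heven : Even n) (hk : k < n) :
    ∃ G : SimpleGraph (Fin n), ∀ v, deg G v = k := by
  by_cases h : 2 * k ≤ n
  · exact ⟨_, deg_sumGraph n k heven h⟩
  · refine ⟨(sumGraph n (n - 1 - k) heven)ᶜ, fun v => ?_⟩
    rw [deg_compl, deg_sumGraph _ _ _ (by omega)]
    omega

lemma aPoint_realizable (n k : ℕ) (heven : Even n) (hk : k < n) :
    IsRealizableDDP n (aPoint n k) := by
  obtain ⟨G, hG⟩ := exists_regular n k heven hk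
  refine ⟨G, ?_⟩
  ext j
  simp only [aPoint, ddp, hG]
  by_cases h : (j : ℕ) < k
  · have : (j : ℕ) + 1 ≤ k := h
    simp [h, this]
  · have : ¬ ((j : ℕ) + 1 ≤ k) := h
    simp [h, this]

lemma tele (y : ℕ → ℝ) (j N : ℕ) :
    ∑ k ∈ Finset.range N, (if j < k then y k - y (k + 1) else 0) =
      if j < N then y (j + 1) - y N else 0 := by
  induction N with
  | zero => simp
  | succ N ih =>
    rw [Finset.sum_range_succ, ih]
    rcases lt_trichotomy j N with h | h | h
    · simp [h, Nat.lt_succ_of_lt h]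
    · subst h; simp
    · have h1 : ¬ j < N := by omega
      have h2 : ¬ j < N + 1 := by omega
      simp [h1, h2]

lemma convex_Rpoly (n : ℕ) : Convex ℝ (Rpoly n) := by
  rintro x ⟨hx1, hx2, hx3⟩ y ⟨hy1, hy2, hy3⟩ a b ha hb hab
  refine ⟨fun i => ?_, fun i => ?_, fun i j hij => ?_⟩ <;>
    simp only [Pi.add_apply, Pi.smul_apply, smul_eq_mul]
  · calc a * x i + b * y i ≤ a * n + b * n := by gcongr <;> simp [hx1, hy1]
      _ = n := by rw [← add_mul, hab, one_mul]
  · have := mul_nonneg ha (hx2 i)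
    have := mul_nonneg hb (hy2 i)
    linarith
  · have := mul_le_mul_of_nonneg_left (hx3 i j hij) ha
    have := mul_le_mul_of_nonneg_left (hy3 i j hij) hb
    linarith

lemma ddp_mem (n : ℕ) (G : SimpleGraph (Fin n)) : ddp n G ∈ Rpoly n := by
  refine ⟨fun i => ?_, fun i => ?_, fun i j hij => ?_⟩ <;> simp only [ddp]
  · have := Set.ncard_le_card {v : Fin n | (i : ℕ) + 1 ≤ deg G v}
    simp only [Nat.card_eq_fintype_card, Fintype.card_fin] at this
    exact_mod_cast this
  · positivity
  · have h : (i : ℕ) ≤ j := hij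
    have := Set.ncard_le_ncard (s := {v : Fin n | (j : ℕ) + 1 ≤ deg G v})
      (t := {v : Fin n | (i : ℕ) + 1 ≤ deg G v})
      (fun v hv => by simp only [Set.mem_setOf_eq] at hv ⊢; omega) (Set.toFinite _)
    exact_mod_cast this

/-- For even `n`, the convex hull of all realizable dual degree partitions on `n`
vertices is the polytope `{x : n ≥ x_1 ≥ ⋯ ≥ x_{n-1} ≥ 0}`. -/
theorem convexHull_ddp_even (n : ℕ) (hn : 0 < n) (heven : Even n) :
    convexHull ℝ {x : Fin (n - 1) → ℝ | IsRealizableDDP n x} = Rpoly n := by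
  apply Set.Subset.antisymm
  · apply convexHull_min _ (convex_Rpoly n)
    rintro x ⟨G, rfl⟩
    exact ddp_mem n G
  · rintro x ⟨h1, h2, h3⟩
    have hn' : (n : ℝ) ≠ 0 := by positivity
    let y : ℕ → ℝ := fun k =>
      if k = 0 then (n : ℝ) else if h : k - 1 < n - 1 then x ⟨k - 1, h⟩ else 0
    have y0 : y 0 = n := by simp [y]
    have yn : y n = 0 := by simp [y, hn.ne']
    have yj (j : Fin (n - 1)) : y (j + 1) = x j := by simp [y]
    have ymono (k : ℕ) : y (k + 1) ≤ y k := by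
      rcases k with _ | k
      · simp only [y]
        simp only [zero_add, one_ne_zero, if_false, if_true]
        split_ifs
        · exact h1 _
        · positivity
      · simp only [y, Nat.add_sub_cancel, Nat.succ_ne_zero, if_false]
        split_ifs with ha hb
        · exact h3 _ _ (by simp [Fin.le_def])
        · omega
        · exact h2 _
        · exact le_rfl
    have hx : x = ∑ k ∈ Finset.range n, ((y k - y (k + 1)) / n) • aPoint n k := by
      ext j
      have hj : (j : ℕ) < n := by omega
      have := tele y j n
      rw [if_pos hj, yn, yj, sub_zero] at this
      rw [← this, Finset.sum_apply]
      refine Finset.sum_congr rfl fun k _ => ?_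
      simp only [Pi.smul_apply, smul_eq_mul, aPoint]
      split_ifs
      · field_simp
      · simp
    rw [hx]
    refine (convex_convexHull ℝ _).sum_mem (fun k _ => ?_) ?_ (fun k hk => ?_)
    · exact div_nonneg (sub_nonneg.2 (ymono k)) (by positivity)
    · rw [← Finset.sum_div, Finset.sum_range_sub', y0, yn]
      field_simp
      simp
    · exact subset_convexHull ℝ _ (aPoint_realizable n k heven (Finset.mem_range.1 hk))
end

section
/- Let n be an odd positive integer. The set of extreme points of the convex hull in ℝ^{n−1} of all realizable dual degree partitions on n vertices is exactly the union of the sets {a^(k) : 0 ≤ 2k ≤ n−1}, {b^(k,l) : k, l ≥ 0, 2k + 2l ≤ n−3}, and {c^(k,l) : k, l ≥ 0, 2k + 2l ≤ n−3}, where a^(k) = (n,…,n,0,…,0) with 2k entries n and n−1−2k zeros; b^(k,l) = (n,…,n,n−1,…,n−1,0,…,0) with 2k entries n, then 2l+1 entries n−1, then n−2−2k−2l zeros; and c^(k,l) = (n,…,n,1,…,1,0,…,0) with 2k+1 entries n, then 2l+1 entries 1, then n−3−2k−2l zeros. -/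
/-- Indicator step vector. -/
noncomputable def stepV (n m : ℕ) : Fin (n - 1) → ℝ := fun j => if (j : ℕ) < m then 1 else 0

/-- The vector with `n-1` vertices of degree `m` and one of degree `m₁`. -/
noncomputable def wV (n m m₁ : ℕ) : Fin (n - 1) → ℝ := ((n : ℝ) - 1) • stepV n m + stepV n m₁

/-- Common description of the vertex set. -/
def vSet (n : ℕ) : Set (Fin (n - 1) → ℝ) :=
  {x | ∃ m m' : ℕ, m < n ∧ m' < n ∧ Even m' ∧ (Odd m ∨ m = m') ∧ x = wV n m m'}

lemma vSet_eq (n : ℕ) (hn : 0 < n) (hodd : Odd n) :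
    {x | (∃ k : ℕ, 2 * k ≤ n - 1 ∧ x = aPoint n (2 * k)) ∨
           (∃ k l : ℕ, 2 * k + 2 * l + 3 ≤ n ∧ x = bPoint n k l) ∨
           (∃ k l : ℕ, 2 * k + 2 * l + 3 ≤ n ∧ x = cPoint n k l)} = vSet n := by
  ext x
  simp only [Set.mem_ofPred_eq, vSet]
  constructor
  · rintro (⟨k, hk, rfl⟩ | ⟨k, l, hk, rfl⟩ | ⟨k, l, hk, rfl⟩)
    · refine ⟨2 * k, 2 * k, by omega, by omega, by simp, Or.inr rfl, ?_⟩
      funext j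
      simp only [aPoint, wV, stepV, Pi.add_apply, Pi.smul_apply, smul_eq_mul]
      split_ifs <;> simp
    · refine ⟨2 * k + 2 * l + 1, 2 * k, by omega, by omega, by simp, Or.inl ⟨k + l, by ring⟩, ?_⟩
      funext j
      simp only [bPoint, wV, stepV, Pi.add_apply, Pi.smul_apply, smul_eq_mul]
      split_ifs <;> first | omega | simp
    · refine ⟨2 * k + 1, 2 * k + 2 * l + 2, by omega, by omega, ⟨k + l + 1, by ring⟩,
        Or.inl ⟨k, by ring⟩, ?_⟩
      funext j
      simp only [cPoint, wV, stepV, Pi.add_apply, Pi.smul_apply, smul_eq_mul]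
      split_ifs <;> first | omega | simp
  · rintro ⟨m, m', hm, hm', he, ho, rfl⟩
    by_cases hmm : m = m'
    · subst hmm
      obtain ⟨k, rfl⟩ := he
      refine Or.inl ⟨k, by omega, ?_⟩
      funext j
      simp only [aPoint, wV, stepV, Pi.add_apply, Pi.smul_apply, smul_eq_mul]
      split_ifs <;> first | omega | simp
    · have hom : Odd m := ho.resolve_right hmm
      obtain ⟨r, rfl⟩ := hodd
      obtain ⟨k, rfl⟩ := he
      clear ho
      obtain ⟨p, rfl⟩ := hom
      by_cases h : k ≤ p
      · refine Or.inr (Or.inl ⟨k, p - k, by omega, ?_⟩)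
        funext j
        simp only [bPoint, wV, stepV, Pi.add_apply, Pi.smul_apply, smul_eq_mul]
        split_ifs <;> first | omega | simp
      · refine Or.inr (Or.inr ⟨p, k - p - 1, by omega, ?_⟩)
        funext j
        simp only [cPoint, wV, stepV, Pi.add_apply, Pi.smul_apply, smul_eq_mul]
        split_ifs <;> first | omega | simp

lemma ddp_eq (n : ℕ) (G : SimpleGraph (Fin n)) : ddp n G = ∑ v, stepV n (deg G v) := by
  classical
  funext j
  simp only [ddp, stepV, Finset.sum_apply]
  rw [Set.ncard_eq_toFinset_card', Finset.sum_boole]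
  congr 2
  ext v
  simp

lemma deg_eq {n : ℕ} (G : SimpleGraph (Fin n)) [DecidableRel G.Adj] (v : Fin n) :
    deg G v = G.degree v := by
  rw [deg, Set.ncard_eq_toFinset_card', ← SimpleGraph.card_neighborFinset_eq_degree]
  congr 1

lemma exists_even (n : ℕ) (hodd : Odd n) (G : SimpleGraph (Fin n)) : ∃ v, Even (deg G v) := by
  classical
  by_contra! h
  have h1 := G.even_card_odd_degree_vertices
  rw [Finset.filter_true_of_mem] at h1
  · simp at h1
    exact (Nat.not_even_iff_odd.2 hodd) h1
  · intro v _
    rw [← deg_eq]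
    exact Nat.not_even_iff_odd.1 (h v)

lemma deg_lt {n : ℕ} (G : SimpleGraph (Fin n)) (v : Fin n) : deg G v < n := by
  classical
  rw [deg_eq]
  simpa using G.degree_lt_card_verts v

lemma wV_mem (n m m' : ℕ) (hn : 0 < n) (hm : m < n) (hm' : m' < n) (he : Even m') :
    wV n m m' ∈ convexHull ℝ (vSet n) := by
  by_cases ho : Odd m
  · exact subset_convexHull ℝ _ ⟨m, m', hm, hm', he, Or.inl ho, rfl⟩
  · have h1 : wV n m m ∈ convexHull ℝ (vSet n) :=
      subset_convexHull ℝ _ ⟨m, m, hm, hm, Nat.not_odd_iff_even.1 ho, Or.inr rfl, rfl⟩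
    have h2 : wV n m' m' ∈ convexHull ℝ (vSet n) :=
      subset_convexHull ℝ _ ⟨m', m', hm', hm', he, Or.inr rfl, rfl⟩
    have hn' : (1 : ℝ) ≤ n := by exact_mod_cast hn
    have h3 := (convex_convexHull ℝ (vSet n)) h1 h2 (a := ((n : ℝ) - 1) / n) (b := 1 / n)
      (div_nonneg (by linarith) (by linarith)) (by positivity) (by field_simp; ring)
    convert h3 using 1
    funext j
    simp only [wV, Pi.add_apply, Pi.smul_apply, smul_eq_mul]
    field_simp
    ring

lemma real_sub (n : ℕ) (hn : 1 < n) (hodd : Odd n) (G : SimpleGraph (Fin n)) :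
    ddp n G ∈ convexHull ℝ (vSet n) := by
  classical
  obtain ⟨v0, hv0⟩ := exists_even n hodd G
  rw [ddp_eq]
  set d := deg G with hd
  -- number of even vertices
  let ev : Fin n → ℝ := fun v => if Even (d v) then 1 else 0
  have hev0 : ∀ v, 0 ≤ ev v := fun v => by simp only [ev]; split_ifs <;> norm_num
  have hev1 : ∀ v, ev v ≤ 1 := fun v => by simp only [ev]; split_ifs <;> norm_num
  obtain ⟨E, hE⟩ : ∃ E : ℝ, E = ∑ v, ev v := ⟨_, rfl⟩
  have hE1 : 1 ≤ E := by
    rw [hE]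
    calc (1 : ℝ) = ev v0 := by simp [ev, hv0]
      _ ≤ _ := Finset.single_le_sum (fun v _ => hev0 v) (Finset.mem_univ v0)
  have hn' : (1 : ℝ) < n := by exact_mod_cast hn
  let q : Fin n → ℝ := fun v => ev v / E
  let p : Fin n → ℝ := fun v => (1 - ev v / E) / (n - 1)
  have hq0 : ∀ v, 0 ≤ q v := fun v => div_nonneg (hev0 v) (by linarith)
  have hp0 : ∀ v, 0 ≤ p v := fun v => by
    refine div_nonneg ?_ (by linarith)
    have : ev v / E ≤ 1 := by rw [div_le_one (by linarith)]; linarith [hev1 v]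
    linarith
  have hq1 : ∑ v, q v = 1 := by
    simp only [q]
    rw [← Finset.sum_div, ← hE, div_self (by linarith)]
  have hp1 : ∑ v, p v = 1 := by
    simp only [p]
    rw [← Finset.sum_div, Finset.sum_sub_distrib]
    change (_ - ∑ v, q v) / _ = _
    rw [hq1]
    have h0 : (n : ℝ) - 1 ≠ 0 := by linarith
    simpa using div_self h0
  have key : ∑ v, stepV n (d v) = ∑ v, p v • ∑ u, q u •
      (if Even (d u) then wV n (d v) (d u) else wV n (d v0) (d v0)) := by
    have h1 : ∀ v, ∑ u, q u • (if Even (d u) then wV n (d v) (d u) else wV n (d v0) (d v0))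
        = ((n : ℝ) - 1) • stepV n (d v) + ∑ u, q u • stepV n (d u) := by
      intro v
      have : ∀ u, q u • (if Even (d u) then wV n (d v) (d u) else wV n (d v0) (d v0))
          = q u • (((n : ℝ) - 1) • stepV n (d v)) + q u • stepV n (d u) := by
        intro u
        by_cases hu : Even (d u)
        · simp [hu, wV]
        · simp [hu, q, ev]
      rw [Finset.sum_congr rfl (fun u _ => this u), Finset.sum_add_distrib, ← Finset.sum_smul,
        hq1, one_smul]
    simp only [h1, smul_add]
    rw [Finset.sum_add_distrib, ← Finset.sum_smul, hp1, one_smul, ← Finset.sum_add_distrib]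
    refine Finset.sum_congr rfl (fun v _ => ?_)
    rw [smul_smul, ← add_smul]
    have : p v * ((n : ℝ) - 1) + q v = 1 := by
      simp only [p, q]
      rw [div_mul_cancel₀ _ (by linarith)]
      ring
    rw [this, one_smul]
  rw [key]
  have hc := convex_convexHull ℝ (vSet n)
  refine hc.sum_mem (fun v _ => hp0 v) hp1 (fun v _ => ?_)
  refine hc.sum_mem (fun v _ => hq0 v) hq1 (fun u _ => ?_)
  split_ifs with hu
  · exact wV_mem n _ _ (by omega) (deg_lt G v) (deg_lt G u) hu
  · exact wV_mem n _ _ (by omega) (deg_lt G v0) (deg_lt G v0) hv0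


/-- Extended coordinates. -/
noncomputable def extX (n : ℕ) (x : Fin (n - 1) → ℝ) : ℕ → ℝ
  | 0 => n
  | i + 1 => if h : i < n - 1 then x ⟨i, h⟩ else 0

/-- Multiplicity coordinates. -/
noncomputable def mulE (n : ℕ) (x : Fin (n - 1) → ℝ) (i : ℕ) : ℝ := extX n x i - extX n x (i + 1)

/-- The polytope in multiplicity coordinates. -/
def polyP (n : ℕ) : Set (Fin (n - 1) → ℝ) :=
  {x | (∀ i < n, 0 ≤ mulE n x i) ∧ 1 ≤ ∑ i ∈ (Finset.range n).filter Even, mulE n x i}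

lemma extX_comb (n : ℕ) (x y : Fin (n - 1) → ℝ) (a b : ℝ) (hab : a + b = 1) (i : ℕ) :
    extX n (a • x + b • y) i = a * extX n x i + b * extX n y i := by
  cases i with
  | zero => simp only [extX]; rw [← add_mul, hab, one_mul]
  | succ i =>
    simp only [extX]
    split_ifs <;> simp

lemma mulE_comb (n : ℕ) (x y : Fin (n - 1) → ℝ) (a b : ℝ) (hab : a + b = 1) (i : ℕ) :
    mulE n (a • x + b • y) i = a * mulE n x i + b * mulE n y i := by
  simp only [mulE, extX_comb n x y a b hab]; ring

lemma sum_mulE (n : ℕ) (hn : 0 < n) (x : Fin (n - 1) → ℝ) :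
    ∑ i ∈ Finset.range n, mulE n x i = n := by
  simp only [mulE]
  rw [Finset.sum_range_sub']
  obtain ⟨k, rfl⟩ : ∃ k, n = k + 1 := ⟨n - 1, by omega⟩
  simp [extX]

lemma mulE_inj (n : ℕ) (x y : Fin (n - 1) → ℝ) (h : ∀ i < n, mulE n x i = mulE n y i) : x = y := by
  have h1 : ∀ i ≤ n, extX n x i = extX n y i := by
    intro i
    induction i with
    | zero => intro _; simp [extX]
    | succ i ih =>
      intro hi
      have := h i (by omega)
      have := ih (by omega)
      simp only [mulE] at *
      linarith
  funext j
  have := h1 (j + 1) (by omega)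
  simpa [extX] using this

lemma convex_polyP (n : ℕ) : Convex ℝ (polyP n) := by
  intro x hx y hy a b ha hb hab
  refine ⟨fun i hi => ?_, ?_⟩
  · rw [mulE_comb n x y a b hab]
    exact add_nonneg (mul_nonneg ha (hx.1 i hi)) (mul_nonneg hb (hy.1 i hi))
  · simp only [mulE_comb n x y a b hab, Finset.sum_add_distrib, ← Finset.mul_sum]
    nlinarith [hx.2, hy.2]

lemma extX_wV (n m m' : ℕ) (hm : m < n) (hm' : m' < n) (i : ℕ) :
    extX n (wV n m m') i = ((n : ℝ) - 1) * (if i ≤ m then 1 else 0) + (if i ≤ m' then 1 else 0) := by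
  cases i with
  | zero => simp [extX]
  | succ i =>
    simp only [extX, wV, stepV, Pi.add_apply, Pi.smul_apply, smul_eq_mul, Nat.succ_le_iff]
    split_ifs <;> first | omega | simp

lemma mulE_wV (n m m' : ℕ) (hm : m < n) (hm' : m' < n) (i : ℕ) :
    mulE n (wV n m m') i = ((n : ℝ) - 1) * (if i = m then 1 else 0) + (if i = m' then 1 else 0) := by
  simp only [mulE, extX_wV n m m' hm hm']
  split_ifs <;> first | omega | ring

lemma vSet_sub (n : ℕ) (hn : 0 < n) : vSet n ⊆ polyP n := by
  rintro x ⟨m, m', hm, hm', he, -, rfl⟩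
  have hn' : (1 : ℝ) ≤ n := by exact_mod_cast hn
  have h0 : ∀ i, 0 ≤ mulE n (wV n m m') i := by
    intro i
    rw [mulE_wV n m m' hm hm']
    split_ifs <;> simp <;> linarith
  refine ⟨fun i _ => h0 i, ?_⟩
  calc (1 : ℝ) ≤ mulE n (wV n m m') m' := by
        rw [mulE_wV n m m' hm hm']
        split_ifs <;> simp_all
    _ ≤ _ := Finset.single_le_sum (f := fun i => mulE n (wV n m m') i)
        (fun i _ => h0 i) (by simp [hm', he])

lemma extreme_aux (n m m' : ℕ) (hn : 0 < n) (hm : m < n) (hm' : m' < n) (he : Even m')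
    (ho : Odd m ∨ m = m') (y z : Fin (n - 1) → ℝ) (hy : y ∈ polyP n) (hz : z ∈ polyP n)
    (h : wV n m m' ∈ openSegment ℝ y z) : y = wV n m m' := by
  obtain ⟨a, b, ha, hb, hab, hw⟩ := h
  have hc : ∀ i, a * mulE n y i + b * mulE n z i =
      ((n : ℝ) - 1) * (if i = m then 1 else 0) + (if i = m' then 1 else 0) := by
    intro i
    rw [← mulE_comb n y z a b hab, hw, mulE_wV n m m' hm hm']
  have hzero : ∀ i < n, i ≠ m → i ≠ m' → mulE n y i = 0 ∧ mulE n z i = 0 := by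
    intro i hi h1 h2
    have h3 := hc i
    rw [if_neg h1, if_neg h2] at h3
    have h4 := mul_nonneg ha.le (hy.1 i hi)
    have h5 := mul_nonneg hb.le (hz.1 i hi)
    constructor
    · have : a * mulE n y i = 0 := by linarith
      exact (mul_eq_zero.1 this).resolve_left ha.ne'
    · have : b * mulE n z i = 0 := by linarith
      exact (mul_eq_zero.1 this).resolve_left hb.ne'
  have hs := sum_mulE n hn y
  apply mulE_inj
  intro i hi
  rw [mulE_wV n m m' hm hm']
  by_cases hmm : m = m'
  · subst hmm
    rw [Finset.sum_eq_single m (fun j hj hne => (hzero j (Finset.mem_range.1 hj) hne hne).1)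
      (fun hne => absurd (Finset.mem_range.2 hm) hne)] at hs
    by_cases him : i = m
    · subst him; simp [hs]
    · simp [him, (hzero i hi him him).1]
  · have hom : Odd m := ho.resolve_right hmm
    have h1 := hy.2
    have h2 := hz.2
    have hne : ∀ j ∈ (Finset.range n).filter Even, j ≠ m := by
      rintro j hj rfl
      exact (Nat.not_even_iff_odd.2 hom) (Finset.mem_filter.1 hj).2
    have hin : m' ∈ (Finset.range n).filter Even := by simp [hm', he]
    have hlt : ∀ j ∈ (Finset.range n).filter Even, j < n := fun j hj =>
      Finset.mem_range.1 (Finset.mem_filter.1 hj).1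
    rw [Finset.sum_eq_single m' (fun j hj hj' => (hzero j (hlt j hj) (hne j hj) hj').1)
      (fun h => absurd hin h)] at h1
    rw [Finset.sum_eq_single m' (fun j hj hj' => (hzero j (hlt j hj) (hne j hj) hj').2)
      (fun h => absurd hin h)] at h2
    have h3 := hc m'
    rw [if_neg (Ne.symm hmm), if_pos rfl] at h3
    have h4 : mulE n y m' = 1 := by
      apply le_antisymm _ h1
      by_contra! h5
      nlinarith [mul_pos ha (sub_pos.2 h5), mul_nonneg hb.le (sub_nonneg.2 h2)]
    rw [Finset.sum_eq_add_of_mem m m' (Finset.mem_range.2 hm) (Finset.mem_range.2 hm') hmm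
      (fun j hj hj' => (hzero j (Finset.mem_range.1 hj) hj'.1 hj'.2).1)] at hs
    by_cases him : i = m
    · subst him; simp [hmm]; linarith
    · by_cases him' : i = m'
      · subst him'; simp [h4, him]
      · simp [him, him', (hzero i hi him him').1]


lemma exists_invariant {α : Type*} [DecidableEq α] (X : Finset α) (f : α → α)
    (hX : ∀ x ∈ X, f x ∈ X) (hf : ∀ x, f (f x) = x) (hne : ∀ x ∈ X, f x ≠ x) (s : ℕ)
    (hs : 2 * s ≤ X.card) :
    ∃ B : Finset α, B ⊆ X ∧ B.card = 2 * s ∧ ∀ x ∈ B, f x ∈ B := by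
  induction s with
  | zero => exact ⟨∅, by simp, by simp, by simp⟩
  | succ s ih =>
    obtain ⟨B, hB, hc, hi⟩ := ih (by omega)
    obtain ⟨x, hx, hxB⟩ : ∃ x ∈ X, x ∉ B := by
      by_contra! h
      have := Finset.card_le_card (show X ⊆ B from h)
      omega
    have hfx : f x ∉ B := fun h => hxB (by simpa [hf] using hi _ h)
    refine ⟨insert x (insert (f x) B), ?_, ?_, ?_⟩
    · intro y hy
      simp only [Finset.mem_insert] at hy
      rcases hy with rfl | rfl | hy
      · exact hx
      · exact hX _ hx
      · exact hB hy
    · rw [Finset.card_insert_of_notMem, Finset.card_insert_of_notMem hfx, hc]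
      · ring
      · simp only [Finset.mem_insert, not_or]
        exact ⟨(hne x hx).symm, hxB⟩
    · intro y hy
      simp only [Finset.mem_insert] at hy ⊢
      rcases hy with rfl | rfl | hy
      · simp
      · simp [hf]
      · simp [hi y hy]

lemma realize {n : ℕ} {α : Type} [Fintype α] (hα : Fintype.card α = n) (G : SimpleGraph α) :
    IsRealizableDDP n (∑ v : α, stepV n (Set.ncard {w | G.Adj v w})) := by
  let φ : Fin n ≃ α := (Fintype.equivFinOfCardEq hα).symm
  refine ⟨G.comap φ, ?_⟩
  rw [ddp_eq, ← φ.sum_comp]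
  refine Finset.sum_congr rfl (fun v _ => ?_)
  congr 1
  rw [deg, ← Set.ncard_image_of_injective _ φ.injective]
  congr 1
  ext w
  constructor
  · intro hw
    exact ⟨φ.symm w, by simpa using hw, by simp⟩
  · rintro ⟨u, hu, rfl⟩
    exact hu

lemma realize_even (n m : ℕ) (hodd : Odd n) (hm : m < n) (he : Even m) :
    IsRealizableDDP n (wV n m m) := by
  classical
  have : NeZero n := ⟨by omega⟩
  obtain ⟨k, hk⟩ := he
  have h2 : ∀ x : ZMod n, -x = x → x = 0 := by
    intro x hx
    have hx2 : (2 : ZMod n) * x = 0 := by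
      rw [two_mul]; nth_rewrite 1 [← hx]; simp
    have hu : IsUnit (2 : ZMod n) := by
      have := (ZMod.isUnit_iff_coprime 2 n).2 (Nat.coprime_two_left.2 hodd)
      exact_mod_cast this
    exact (hu.mul_right_eq_zero).1 hx2
  obtain ⟨A, hA, hAc, hAi⟩ := exists_invariant (Finset.univ.erase (0 : ZMod n)) (fun x => -x)
    (by simp) (by simp) (by
      intro x hx h
      simp only [Finset.mem_erase] at hx
      exact hx.1 (h2 x h)) k (by
      rw [Finset.card_erase_of_mem (Finset.mem_univ _), Finset.card_univ, ZMod.card]; omega)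
  let G : SimpleGraph (ZMod n) :=
    { Adj := fun i j => j - i ∈ A
      symm := ⟨fun i j h => by simpa using hAi _ h⟩
      loopless := ⟨fun i h => by simpa using hA h⟩ }
  have hd : ∀ v, Set.ncard {w | G.Adj v w} = m := by
    intro v
    have : {w | G.Adj v w} = (fun x => v + x) '' (A : Set (ZMod n)) := by
      ext w
      constructor
      · intro h
        exact ⟨w - v, h, by simp⟩
      · rintro ⟨x, hx, rfl⟩
        simpa [G] using hx
    rw [this, Set.ncard_image_of_injective _ (add_right_injective v), Set.ncard_coe_finset, hAc]
    omega
  have := realize (ZMod.card n) G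
  simp only [hd] at this
  convert this using 1
  funext j
  simp [wV, ZMod.card]
  ring

lemma realize_odd (n m m' : ℕ) (hodd : Odd n) (hm : m < n) (hm' : m' < n) (he : Even m')
    (ho : Odd m) : IsRealizableDDP n (wV n m m') := by
  classical
  obtain ⟨q, hq⟩ := hodd
  obtain ⟨s, hs⟩ := he
  obtain ⟨r, hr⟩ := ho
  have hN : NeZero (2 * q) := ⟨by omega⟩
  let t : ZMod (2 * q) := (q : ℕ)
  have htt : t + t = 0 := by
    have : ((2 * q : ℕ) : ZMod (2 * q)) = 0 := ZMod.natCast_self _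
    simp only [t]; rw [← this]; push_cast; ring
  have ht0 : t ≠ 0 := by
    intro h
    have := (ZMod.natCast_eq_zero_iff q (2 * q)).1 h
    have := Nat.le_of_dvd (by omega) this
    omega
  have hneg : -t = t := by rw [neg_eq_iff_add_eq_zero, htt]
  have h2 : ∀ x : ZMod (2 * q), -x = x → x = 0 ∨ x = t := by
    intro x hx
    have hx2 : x + x = 0 := by nth_rewrite 1 [← hx]; simp
    have hv : ((x.val + x.val : ℕ) : ZMod (2 * q)) = 0 := by
      push_cast; simpa using hx2
    rw [ZMod.natCast_eq_zero_iff] at hv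
    obtain ⟨c, hc⟩ := hv
    have hlt := ZMod.val_lt x
    have hc2 : c < 2 := by
      by_contra! h
      nlinarith
    interval_cases c
    · left
      exact (ZMod.val_eq_zero x).1 (by omega)
    · right
      have : x.val = q := by omega
      rw [← ZMod.natCast_zmod_val x, this]
  obtain ⟨A, hA, hAc, hAi⟩ := exists_invariant ((Finset.univ.erase (0 : ZMod (2 * q))).erase t)
    (fun x => -x)
    (by
      intro x hx
      simp only [Finset.mem_erase, Finset.mem_univ, and_true] at hx ⊢
      refine ⟨fun h => hx.1 ?_, by simpa using hx.2⟩
      rw [← hneg, ← h, neg_neg]) (by simp) (by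
      intro x hx h
      simp only [Finset.mem_erase, Finset.mem_univ, and_true] at hx
      have := h2 x h
      tauto) r (by
      rw [Finset.card_erase_of_mem (by simp [ht0]), Finset.card_erase_of_mem (Finset.mem_univ _),
        Finset.card_univ, ZMod.card]; omega)
  have hA0 : (0 : ZMod (2 * q)) ∉ A := fun h => by simpa using hA h
  have hAt : t ∉ A := fun h => by simpa using hA h
  obtain ⟨B, -, hBc, hBi⟩ := exists_invariant (Finset.univ : Finset (ZMod (2 * q)))
    (fun x => x + t) (by simp) (fun x => by rw [add_assoc, htt, add_zero])
    (by intro x _ h; exact ht0 (by simpa using h)) s (by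
      rw [Finset.card_univ, ZMod.card]; omega)
  let adj : Option (ZMod (2 * q)) → Option (ZMod (2 * q)) → Prop
    | none, none => False
    | none, some i => i ∈ B
    | some i, none => i ∈ B
    | some i, some j => j - i ∈ A ∨ (j = i + t ∧ i ∉ B)
  let G : SimpleGraph (Option (ZMod (2 * q))) :=
    { Adj := adj
      symm := ⟨by
        rintro (_ | i) (_ | j) h
        · exact h
        · exact h
        · exact h
        · rcases h with h | ⟨h, h'⟩
          · left; simpa using hAi _ h
          · right
            subst h
            refine ⟨by rw [add_assoc, htt, add_zero], fun h => h' ?_⟩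
            have := hBi _ h
            simpa [add_assoc, htt] using this⟩
      loopless := ⟨by
        rintro (_ | i) h
        · exact h
        · rcases h with h | ⟨h, h'⟩
          · exact hA0 (by simpa using h)
          · exact ht0 (by simpa using h)⟩ }
  have hdn : Set.ncard {w | G.Adj none w} = m' := by
    have : {w | G.Adj none w} = some '' (B : Set (ZMod (2 * q))) := by
      ext w
      constructor
      · intro h
        rcases w with _ | i
        · exact absurd h id
        · exact ⟨i, h, rfl⟩
      · rintro ⟨x, hx, rfl⟩
        exact hx
    rw [this, Set.ncard_image_of_injective _ (Option.some_injective _), Set.ncard_coe_finset, hBc]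
    omega
  have hinj : ∀ i : ZMod (2 * q), Function.Injective (fun x => some (i + x)) := by
    intro i x y h
    simpa using h
  have hds : ∀ i, Set.ncard {w | G.Adj (some i) w} = m := by
    intro i
    by_cases hi : i ∈ B
    · have : {w | G.Adj (some i) w} =
          insert none ((fun x => some (i + x)) '' (A : Set (ZMod (2 * q)))) := by
        ext w
        constructor
        · intro h
          rcases w with _ | j
          · exact Or.inl rfl
          · right
            rcases h with h | ⟨h, h'⟩
            · exact ⟨j - i, h, by simp⟩
            · exact absurd hi h'
        · rintro (rfl | ⟨x, hx, rfl⟩)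
          · exact hi
          · left; simpa using hx
      rw [this, Set.ncard_insert_of_notMem (by simp), Set.ncard_image_of_injective _ (hinj i),
        Set.ncard_coe_finset, hAc]
      omega
    · have : {w | G.Adj (some i) w} =
          ((fun x => some (i + x)) '' ((insert t A : Finset (ZMod (2 * q))) : Set (ZMod (2 * q)))) := by
        ext w
        constructor
        · intro h
          rcases w with _ | j
          · exact absurd h hi
          · rcases h with h | ⟨h, h'⟩
            · exact ⟨j - i, by simp [h], by simp⟩
            · exact ⟨t, by simp, by simp [h]⟩
        · rintro ⟨x, hx, rfl⟩
          simp only [Finset.coe_insert, Set.mem_insert_iff, Finset.mem_coe] at hx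
          rcases hx with rfl | hx
          · right; exact ⟨rfl, hi⟩
          · left; simpa using hx
      rw [this, Set.ncard_image_of_injective _ (hinj i),
        Set.ncard_coe_finset, Finset.card_insert_of_notMem hAt, hAc]
      omega
  have := realize (n := n) (by rw [Fintype.card_option, ZMod.card]; omega) G
  rw [Fintype.sum_option] at this
  simp only [hdn, hds] at this
  convert this using 1
  funext j
  simp [wV, ZMod.card, hq]
  ring

lemma vSet_real (n : ℕ) (hodd : Odd n) : vSet n ⊆ {x | IsRealizableDDP n x} := by
  rintro x ⟨m, m', hm, hm', he, ho, rfl⟩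
  rcases ho with ho | rfl
  · exact realize_odd n m m' hodd hm hm' he ho
  · exact realize_even n m hodd hm he

/-- For odd `n`, the extreme points of the convex hull of all realizable dual degree
partitions on `n` vertices are exactly the points `a^(k)` (`0 ≤ 2k ≤ n-1`),
`b^(k,l)` and `c^(k,l)` (`k, l ≥ 0`, `2k + 2l ≤ n-3`). -/
theorem extremePoints_ddp_odd (n : ℕ) (hn : 0 < n) (hodd : Odd n) :
    Set.extremePoints ℝ (convexHull ℝ {x : Fin (n - 1) → ℝ | IsRealizableDDP n x}) =
      {x | (∃ k : ℕ, 2 * k ≤ n - 1 ∧ x = aPoint n (2 * k)) ∨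
           (∃ k l : ℕ, 2 * k + 2 * l + 3 ≤ n ∧ x = bPoint n k l) ∨
           (∃ k l : ℕ, 2 * k + 2 * l + 3 ≤ n ∧ x = cPoint n k l)} := by
  rw [vSet_eq n hn hodd]
  have hsub : {x : Fin (n - 1) → ℝ | IsRealizableDDP n x} ⊆ convexHull ℝ (vSet n) := by
    rintro x ⟨G, rfl⟩
    by_cases h1 : 1 < n
    · exact real_sub n h1 hodd G
    · obtain rfl : n = 1 := by omega
      have : ddp 1 G = wV 1 0 0 := by
        funext j; exact j.elim0
      rw [this]
      exact wV_mem 1 0 0 (by omega) (by omega) (by omega) (by simp)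
  have heq : convexHull ℝ {x : Fin (n - 1) → ℝ | IsRealizableDDP n x} = convexHull ℝ (vSet n) :=
    Set.Subset.antisymm (convexHull_min hsub (convex_convexHull ℝ _))
      (convexHull_mono (vSet_real n hodd))
  rw [heq]
  refine Set.Subset.antisymm extremePoints_convexHull_subset ?_
  have hP : convexHull ℝ (vSet n) ⊆ polyP n := convexHull_min (vSet_sub n hn) (convex_polyP n)
  intro x hx
  refine ⟨subset_convexHull ℝ _ hx, ?_⟩
  intro y hy z hz hxyz
  obtain ⟨m, m', hm, hm', he, ho, rfl⟩ := hx
  exact extreme_aux n m m' hn hm hm' he ho y z (hP hy) (hP hz) hxyz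
end

section
/- Let n be an odd positive integer and let k, l be nonnegative integers with 2k + 2l ≤ n−3. Then the sequence d consisting of n−1 entries equal to 2k+2l+1 followed by one entry equal to 2k is the degree sequence of a simple graph on n vertices, and the dual degree partition of any such graph is b^(k,l) = (n, …, n, n−1, …, n−1, 0, …, 0) with 2k entries equal to n, then 2l+1 entries equal to n−1, then n−2−2k−2l zeros. -/
/-- `d` is the degree sequence of a simple graph on `n` vertices: some graph `G` on
`Fin n` has its degrees, listed in some order (here `d` is assumed nonincreasing). -/
def IsDegreeSequence (n : ℕ) (d : Fin n → ℕ) : Prop :=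
  ∃ (G : SimpleGraph (Fin n)) (σ : Equiv.Perm (Fin n)), ∀ i, deg G (σ i) = d i

/-- The underlying vertex set carries a cyclic group plus one extra vertex. -/
def auxGraph {A : Type*} [AddCommGroup A] (S P : Set A) (t : A) (ht : t + t = 0) (ht0 : t ≠ 0)
    (h0 : (0 : A) ∉ S) (hS : ∀ x ∈ S, -x ∈ S) (hP : ∀ x ∈ P, x + t ∈ P) :
    SimpleGraph (Option A) where
  Adj x y := match x, y with
    | none, none => False
    | none, some j => j ∈ P
    | some i, none => i ∈ P
    | some i, some j => j - i ∈ S ∨ (j = i + t ∧ i ∉ P)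
  symm := ⟨by
    rintro (_ | i) (_ | j) h
    · exact h
    · exact h
    · exact h
    · rcases h with h | ⟨h, h'⟩
      · left
        have := hS _ h
        rwa [neg_sub] at this
      · right
        have e : i = j + t := by rw [h, add_assoc, ht, add_zero]
        refine ⟨e, fun hj => h' ?_⟩
        rw [e]
        exact hP _ hj⟩
  loopless := ⟨by
    rintro (_ | i) h
    · exact h
    · rcases h with h | ⟨h, -⟩
      · rw [sub_self] at h
        exact h0 h
      · exact ht0 (by simpa using h.symm)⟩

lemma auxGraph_none {A : Type*} [AddCommGroup A] (S P : Set A) (t : A) (ht : t + t = 0)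
    (ht0 : t ≠ 0) (h0 : (0 : A) ∉ S) (hS : ∀ x ∈ S, -x ∈ S) (hP : ∀ x ∈ P, x + t ∈ P) :
    Set.ncard {y | (auxGraph S P t ht ht0 h0 hS hP).Adj none y} = P.ncard := by
  have : {y | (auxGraph S P t ht ht0 h0 hS hP).Adj none y} = some '' P := by
    ext (_ | j) <;> simp [auxGraph]
  rw [this, Set.ncard_image_of_injective _ (Option.some_injective _)]

lemma auxGraph_some {A : Type*} [AddCommGroup A] [Finite A] (S P : Set A) (t : A)
    (ht : t + t = 0)
    (ht0 : t ≠ 0) (h0 : (0 : A) ∉ S) (hS : ∀ x ∈ S, -x ∈ S) (hP : ∀ x ∈ P, x + t ∈ P)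
    (htS : t ∉ S) (i : A) :
    Set.ncard {y | (auxGraph S P t ht ht0 h0 hS hP).Adj (some i) y} = S.ncard + 1 := by
  classical
  have : {y | (auxGraph S P t ht ht0 h0 hS hP).Adj (some i) y} =
      insert (if i ∈ P then none else some (i + t)) ((fun s => some (i + s)) '' S) := by
    have key : ∀ j, (∃ x ∈ S, i + x = j) ↔ j - i ∈ S := by
      intro j
      constructor
      · rintro ⟨x, hx, rfl⟩
        simpa using hx
      · intro h
        exact ⟨_, h, by abel⟩
    ext (_ | j)
    · by_cases hi : i ∈ P <;> simp [auxGraph, hi]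
    · by_cases hi : i ∈ P <;> simp [auxGraph, hi, key, or_comm]
  rw [this, Set.ncard_insert_of_notMem, Set.ncard_image_of_injective]
  · intro a b h
    simpa using h
  · by_cases hi : i ∈ P <;> simp [hi, htS]

lemma card_fin_set (m : ℕ) (T : Finset ℕ) (hT : ∀ x ∈ T, x < m) :
    Set.ncard {i : Fin m | (i : ℕ) ∈ T} = T.card := by
  rw [← Set.ncard_coe_finset T, ← Set.ncard_image_of_injective _ Fin.val_injective]
  congr 1
  ext x
  simp only [Set.mem_image, Set.mem_setOf_eq, Finset.mem_coe]
  constructor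
  · rintro ⟨y, hy, rfl⟩
    exact hy
  · intro h
    exact ⟨⟨x, hT x h⟩, h, rfl⟩

lemma exists_aux (h k s : ℕ) (hk : k ≤ s) (hs : s < h) :
    ∃ G : SimpleGraph (Option (Fin (2 * h))), Set.ncard {y | G.Adj none y} = 2 * k ∧
      ∀ i, Set.ncard {y | G.Adj (some i) y} = 2 * s + 1 := by
  haveI : NeZero (2 * h) := ⟨by omega⟩
  let T : Finset ℕ := Finset.Ico 1 (s + 1) ∪ Finset.Ico (2 * h - s) (2 * h)
  let Q : Finset ℕ := Finset.Ico 0 k ∪ Finset.Ico h (h + k)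
  have hTm : ∀ x, x ∈ T ↔ (1 ≤ x ∧ x < s + 1) ∨ (2 * h - s ≤ x ∧ x < 2 * h) := by
    intro x
    simp [T]
  have hQm : ∀ x, x ∈ Q ↔ x < k ∨ (h ≤ x ∧ x < h + k) := by
    intro x
    simp [Q]
  have hTc : T.card = 2 * s := by
    rw [Finset.card_union_of_disjoint]
    · simp
      omega
    · rw [Finset.disjoint_left]
      intro x
      simp
      omega
  have hQc : Q.card = 2 * k := by
    rw [Finset.card_union_of_disjoint]
    · simp
      omega
    · rw [Finset.disjoint_left]
      intro x
      simp
      omega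
  let t : Fin (2 * h) := ⟨h, by omega⟩
  have ht : t + t = 0 := by
    ext
    simp [t, Fin.val_add, ← two_mul]
  have ht0 : t ≠ 0 := by
    intro e
    have := congrArg Fin.val e
    simp [t] at this
    omega
  refine ⟨auxGraph {i | (i : ℕ) ∈ T} {i | (i : ℕ) ∈ Q} t ht ht0 ?_ ?_ ?_, ?_, ?_⟩
  · simp [hTm]
    omega
  · intro x hx
    have hx2 := x.2
    simp only [Set.mem_setOf_eq, hTm, Fin.val_neg'] at hx ⊢
    rw [Nat.mod_eq_of_lt (by omega)]
    omega
  · intro x hx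
    have hx2 := x.2
    simp only [Set.mem_setOf_eq, hQm, Fin.val_add] at hx ⊢
    have : (x : ℕ) + (t : ℕ) = x + h := rfl
    rw [this]
    by_cases hc : (x : ℕ) + h < 2 * h
    · rw [Nat.mod_eq_of_lt hc]
      omega
    · rw [Nat.mod_eq_sub_mod (by omega), Nat.mod_eq_of_lt (by omega)]
      omega
  · rw [auxGraph_none, card_fin_set _ _ (by intro x; rw [hQm]; omega), hQc]
  · intro i
    rw [auxGraph_some, card_fin_set _ _ (by intro x; rw [hTm]; omega), hTc]
    simp [t, hTm]
    omega

/-- For odd `n` and `2k + 2l ≤ n - 3`, the sequence with `n-1` entries `2k+2l+1`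
followed by one entry `2k` is the degree sequence of a simple graph on `n` vertices,
and the dual degree partition of any such graph is `b^(k,l)`. -/
theorem bPoint_realizable (n k l : ℕ) (hodd : Odd n) (hkl : 2 * k + 2 * l + 3 ≤ n) :
    IsDegreeSequence n (fun i => if (i : ℕ) < n - 1 then 2 * k + 2 * l + 1 else 2 * k) ∧
      ∀ G : SimpleGraph (Fin n),
        (∃ σ : Equiv.Perm (Fin n),
            ∀ i, deg G (σ i) = if (i : ℕ) < n - 1 then 2 * k + 2 * l + 1 else 2 * k) →
        ddp n G = bPoint n k l := by
  constructor
  · obtain ⟨h, rfl⟩ := hodd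
    obtain ⟨G, hG0, hG⟩ := exists_aux h k (k + l) (by omega) (by omega)
    let e : Fin (2 * h + 1) ≃ Option (Fin (2 * h)) := finSuccEquivLast
    have hdeg : ∀ i, deg (G.comap e) i = Set.ncard {y | G.Adj (e i) y} := by
      intro i
      rw [deg, ← Set.ncard_image_of_injective _ e.injective]
      congr 1
      ext y
      simp only [Set.mem_image, Set.mem_setOf_eq, SimpleGraph.comap_adj]
      constructor
      · rintro ⟨z, hz, rfl⟩
        exact hz
      · intro hy
        exact ⟨e.symm y, by simpa using hy, by simp⟩
    refine ⟨G.comap e, Equiv.refl _, fun i => ?_⟩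
    rw [Equiv.refl_apply, hdeg]
    induction i using Fin.lastCases with
    | last => simp [e, hG0]
    | cast i =>
      have hi := i.2
      simp [e, hG]
      omega
  · rintro G ⟨σ, hσ⟩
    funext j
    have hj := j.2
    have h1 : Set.ncard {v : Fin n | (j : ℕ) + 1 ≤ deg G v} =
        Set.ncard {i : Fin n | (j : ℕ) + 1 ≤ deg G (σ i)} := by
      rw [← Set.ncard_image_of_injective {i : Fin n | (j : ℕ) + 1 ≤ deg G (σ i)} σ.injective]
      congr 1
      ext y
      simp only [Set.mem_image, Set.mem_setOf_eq]
      constructor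
      · intro hy
        exact ⟨σ.symm y, by simpa using hy, by simp⟩
      · rintro ⟨z, hz, rfl⟩
        exact hz
    have h2 : ∀ c, c ≤ n → (∀ i : Fin n, (j : ℕ) + 1 ≤ deg G (σ i) ↔ (i : ℕ) < c) →
        Set.ncard {v : Fin n | (j : ℕ) + 1 ≤ deg G v} = c := by
      intro c hc hi
      rw [h1]
      have := card_fin_set n (Finset.range c) (by intro x hx; have := Finset.mem_range.1 hx; omega)
      simp only [Finset.mem_range, Finset.card_range] at this
      simp only [hi]
      exact this
    simp only [ddp, bPoint]
    split_ifs with ha hb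
    · rw [h2 n le_rfl]
      intro i
      have := i.2
      rw [hσ]
      split_ifs <;> omega
    · rw [h2 (n - 1) (by omega), Nat.cast_sub (by omega)]
      · simp
      intro i
      have := i.2
      rw [hσ]
      split_ifs <;> omega
    · rw [h2 0 (by omega)]
      · simp
      intro i
      have := i.2
      rw [hσ]
      split_ifs <;> omega
end

section
/- Let n be an odd positive integer and let k, l be nonnegative integers with 2k + 2l ≤ n−3. Then the sequence d consisting of one entry equal to 2k+2l+2 followed by n−1 entries equal to 2k+1 is the degree sequence of a simple graph on n vertices, and the dual degree partition of any such graph is c^(k,l) = (n, …, n, 1, …, 1, 0, …, 0) with 2k+1 entries equal to n, then 2l+1 entries equal to 1, then n−3−2k−2l zeros. -/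
/-- Counting residues by their representatives. -/
lemma ncard_zmod (N : ℕ) [NeZero N] (p : ℕ → Prop) [DecidablePred p] :
    Set.ncard {i : ZMod N | p i.val} = ((Finset.range N).filter p).card := by
  rw [← Set.ncard_image_of_injective _ (ZMod.val_injective N), ← Set.ncard_coe_finset]
  congr 1
  ext x
  simp only [Set.mem_image, Set.mem_ofPred_eq, Finset.coe_filter, Finset.mem_range]
  constructor
  · rintro ⟨i, hi, rfl⟩
    exact ⟨ZMod.val_lt i, hi⟩
  · rintro ⟨hx, hp⟩
    exact ⟨(x : ZMod N), by rwa [ZMod.val_cast_of_lt hx], ZMod.val_cast_of_lt hx⟩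

/-- The connection set of the circulant part. -/
def connSet (N k : ℕ) : Set (ZMod N) :=
  {s | (1 ≤ s.val ∧ s.val ≤ k) ∨ N - k ≤ s.val}

lemma connSet_neg (N k : ℕ) [NeZero N] (hk : k < N) (s : ZMod N) (hs : s ∈ connSet N k) :
    -s ∈ connSet N k := by
  have h0 := ZMod.val_lt s
  simp only [connSet, Set.mem_ofPred_eq] at hs ⊢
  rw [ZMod.neg_val]
  split_ifs with h
  · subst h
    simp only [ZMod.val_zero] at hs
    omega
  · have : s.val ≠ 0 := by simpa [ZMod.val_eq_zero] using h
    omega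

lemma connSet_ncard (N k : ℕ) [NeZero N] (hk : 2 * k < N) : (connSet N k).ncard = 2 * k := by
  unfold connSet
  rw [ncard_zmod N (fun x => (1 ≤ x ∧ x ≤ k) ∨ N - k ≤ x)]
  have : (Finset.range N).filter (fun x => (1 ≤ x ∧ x ≤ k) ∨ N - k ≤ x)
      = Finset.Icc 1 k ∪ Finset.Ico (N - k) N := by
    ext x
    simp only [Finset.mem_filter, Finset.mem_range, Finset.mem_union, Finset.mem_Icc,
      Finset.mem_Ico]
    omega
  rw [this, Finset.card_union_of_disjoint]
  · simp only [Nat.card_Icc, Nat.card_Ico]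
    omega
  · rw [Finset.disjoint_left]
    intro x
    simp only [Finset.mem_Icc, Finset.mem_Ico]
    omega

lemma hubSet_ncard (m t : ℕ) [NeZero (2 * m)] (ht : t ≤ m) :
    Set.ncard {i : ZMod (2 * m) | i.val % m < t} = 2 * t := by
  rw [ncard_zmod (2 * m) (fun x => x % m < t)]
  have : (Finset.range (2 * m)).filter (fun x => x % m < t)
      = Finset.range t ∪ Finset.Ico m (m + t) := by
    ext x
    simp only [Finset.mem_filter, Finset.mem_range, Finset.mem_union, Finset.mem_Ico]
    rcases lt_or_ge x m with h | h
    · rw [Nat.mod_eq_of_lt h]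
      omega
    · constructor
      · rintro ⟨h1, h2⟩
        rw [Nat.mod_eq_sub_mod h, Nat.mod_eq_of_lt (by omega)] at h2
        omega
      · intro h1
        rw [Nat.mod_eq_sub_mod h, Nat.mod_eq_of_lt (by omega)]
        omega
  rw [this, Finset.card_union_of_disjoint]
  · simp only [Finset.card_range, Nat.card_Ico]
    omega
  · rw [Finset.disjoint_left]
    intro x
    simp only [Finset.mem_range, Finset.mem_Ico]
    omega

lemma hub_shift (m : ℕ) [NeZero (2 * m)] (i : ZMod (2 * m)) :
    (i + (m : ZMod (2 * m))).val % m = i.val % m := by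
  rw [ZMod.val_add, Nat.mod_mod_of_dvd _ (Dvd.intro_left 2 rfl), ZMod.val_natCast, Nat.add_mod,
    Nat.mod_mod_of_dvd _ (Dvd.intro_left 2 rfl)]
  simp

lemma two_m (m : ℕ) : (m : ZMod (2 * m)) + m = 0 := by
  have : ((2 * m : ℕ) : ZMod (2 * m)) = 0 := ZMod.natCast_self _
  push_cast at this
  rw [← this]
  ring

/-- Adjacency of the model graph. -/
def mAdj (m k t : ℕ) : Option (ZMod (2 * m)) → Option (ZMod (2 * m)) → Prop
  | none, none => False
  | none, some i => i.val % m < t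
  | some i, none => i.val % m < t
  | some i, some j => j - i ∈ connSet (2 * m) k ∨ (j = i + m ∧ ¬ i.val % m < t)

/-- The model graph: a circulant graph whose antipodal matching is partly rerouted via a hub. -/
def mGraph (m k t : ℕ) [NeZero (2 * m)] (hk : k < m) : SimpleGraph (Option (ZMod (2 * m))) where
  Adj := mAdj m k t
  symm := ⟨by
    rintro (_ | i) (_ | j) h
    · exact h
    · exact h
    · exact h
    · rcases h with h | ⟨rfl, h⟩
      · left
        have := connSet_neg _ _ (by omega) _ h
        rwa [neg_sub] at this
      · right
        refine ⟨?_, ?_⟩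
        · rw [add_assoc, two_m, add_zero]
        · rwa [hub_shift]⟩
  loopless := ⟨by
    rintro (_ | i) h
    · exact h
    · rcases h with h | ⟨h, -⟩
      · simp only [sub_self, connSet, Set.mem_ofPred_eq, ZMod.val_zero] at h
        omega
      · have h1 : (m : ZMod (2 * m)) = 0 := by simpa using h
        have h2 := congrArg ZMod.val h1
        rw [ZMod.val_natCast, Nat.mod_eq_of_lt (by omega), ZMod.val_zero] at h2
        omega⟩

lemma mAdj_none (m k t : ℕ) [NeZero (2 * m)] (ht : t ≤ m) :
    Set.ncard {w | mAdj m k t none w} = 2 * t := by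
  have h : {w | mAdj m k t none w} = some '' {i : ZMod (2 * m) | i.val % m < t} := by
    ext w
    rcases w with _ | i <;> simp [mAdj]
  rw [h, Set.ncard_image_of_injective _ (Option.some_injective _), hubSet_ncard m t ht]

lemma mAdj_some (m k t : ℕ) [NeZero (2 * m)] (hk : k < m) (i : ZMod (2 * m)) :
    Set.ncard {w | mAdj m k t (some i) w} = 2 * k + 1 := by
  classical
  have hinj : Function.Injective (fun s : ZMod (2 * m) => some (i + s)) := by
    intro a b h
    simpa using h
  have hset : {w | mAdj m k t (some i) w} =
      insert (if i.val % m < t then none else some (i + (m : ZMod (2 * m))))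
        ((fun s : ZMod (2 * m) => some (i + s)) '' connSet (2 * m) k) := by
    ext w
    rcases w with _ | j
    · by_cases h : i.val % m < t <;> simp [mAdj, h]
    · have e : (∃ s ∈ connSet (2 * m) k, i + s = j) ↔ j - i ∈ connSet (2 * m) k := by
        constructor
        · rintro ⟨s, hs, rfl⟩
          simpa using hs
        · intro h
          exact ⟨_, h, by ring⟩
      by_cases h : i.val % m < t
      · simp [mAdj, h, e]
      · simp [mAdj, e, not_lt.mp h, h, or_comm]
  rw [hset, Set.ncard_insert_of_notMem _ (Set.toFinite _),
    Set.ncard_image_of_injective _ hinj, connSet_ncard _ _ (by omega)]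
  split_ifs with h
  · simp
  · rintro ⟨s, hs, h1⟩
    have h2 : s = (m : ZMod (2 * m)) := by simpa using h1
    subst h2
    simp only [connSet, Set.mem_ofPred_eq] at hs
    rw [ZMod.val_natCast, Nat.mod_eq_of_lt (by omega)] at hs
    omega

/-- For odd `n` and `2k + 2l ≤ n - 3`, the sequence with one entry `2k+2l+2` followed by
`n-1` entries `2k+1` is the degree sequence of a simple graph on `n` vertices, and the
dual degree partition of any such graph is `c^(k,l)`. -/
theorem cPoint_realizable (n k l : ℕ) (hodd : Odd n) (hkl : 2 * k + 2 * l + 3 ≤ n) :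
    IsDegreeSequence n (fun i => if (i : ℕ) = 0 then 2 * k + 2 * l + 2 else 2 * k + 1) ∧
      ∀ G : SimpleGraph (Fin n),
        (∃ σ : Equiv.Perm (Fin n),
            ∀ i, deg G (σ i) = if (i : ℕ) = 0 then 2 * k + 2 * l + 2 else 2 * k + 1) →
        ddp n G = cPoint n k l := by
  constructor
  · obtain ⟨m, rfl⟩ := hodd
    haveI : NeZero (2 * m) := ⟨by omega⟩
    have hk : k < m := by omega
    let e : Fin (2 * m + 1) ≃ Option (ZMod (2 * m)) :=
      (finSuccEquiv (2 * m)).trans (Equiv.optionCongr (ZMod.finEquiv (2 * m)).toEquiv)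
    refine ⟨(mGraph m k (k + l + 1) hk).comap e, Equiv.refl _, ?_⟩
    have hd : ∀ v, deg ((mGraph m k (k + l + 1) hk).comap e) v =
        Set.ncard {w | mAdj m k (k + l + 1) (e v) w} := by
      intro v
      rw [← Set.ncard_preimage_of_injective_subset_range e.injective (by simp)]
      rfl
    intro i
    rw [Equiv.refl_apply, hd]
    refine Fin.cases ?_ (fun j => ?_) i
    · have h0 : e 0 = none := by simp [e]
      rw [h0, mAdj_none _ _ _ (by omega)]
      simp
      ring
    · have h0 : e j.succ = some (ZMod.finEquiv (2 * m) j) := by simp [e]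
      rw [h0, mAdj_some _ _ _ hk]
      simp
  · rintro G ⟨σ, hσ⟩
    funext j
    have hn : 0 < n := by omega
    have key : {v : Fin n | (j : ℕ) + 1 ≤ deg G v} = σ '' {i : Fin n | (j : ℕ) + 1 ≤
        if (i : ℕ) = 0 then 2 * k + 2 * l + 2 else 2 * k + 1} := by
      ext v
      simp only [Set.mem_image, Set.mem_ofPred_eq]
      constructor
      · intro h
        refine ⟨σ.symm v, ?_, by simp⟩
        rw [← hσ]
        simpa using h
      · rintro ⟨i, hi, rfl⟩
        rwa [hσ]
    unfold ddp cPoint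
    rw [key, Set.ncard_image_of_injective _ σ.injective]
    split_ifs with h1 h2
    · have : {i : Fin n | (j : ℕ) + 1 ≤
          if (i : ℕ) = 0 then 2 * k + 2 * l + 2 else 2 * k + 1} = Set.univ := by
        ext i
        simp only [Set.mem_ofPred_eq, Set.mem_univ, iff_true]
        split_ifs <;> omega
      rw [this]
      simp
    · have : {i : Fin n | (j : ℕ) + 1 ≤
          if (i : ℕ) = 0 then 2 * k + 2 * l + 2 else 2 * k + 1} = {⟨0, hn⟩} := by
        ext i
        simp only [Set.mem_ofPred_eq, Set.mem_singleton_iff, Fin.ext_iff]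
        split_ifs <;> omega
      rw [this]
      simp
    · have : {i : Fin n | (j : ℕ) + 1 ≤
          if (i : ℕ) = 0 then 2 * k + 2 * l + 2 else 2 * k + 1} = ∅ := by
        ext i
        simp only [Set.mem_ofPred_eq, Set.mem_empty_iff_false, iff_false]
        split_ifs <;> omega
      rw [this]
      simp
end

section
/- Let n be an odd positive integer and let x = (x_1, …, x_{n−1}) ∈ ℝ^{n−1} be a realizable dual degree partition on n vertices. Then (x_1 − x_2) + (x_3 − x_4) + … + (x_{n−2} − x_{n−1}) ≤ n − 1. -/
theorem alt_indicator_sum (m d : ℕ) :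
    ∑ i ∈ Finset.range m, ((if 2 * i + 1 ≤ d then (1 : ℝ) else 0) -
      (if 2 * i + 1 + 1 ≤ d then (1 : ℝ) else 0)) = if Odd d ∧ d < 2 * m then 1 else 0 := by
  induction m with
  | zero => simp
  | succ m ih =>
    rw [Finset.sum_range_succ, ih]
    simp only [Nat.odd_iff]
    split_ifs <;> first | omega | norm_num

open Classical in
theorem ncard_eq_sum_ind {n : ℕ} (p : Fin n → Prop) :
    ((Set.ncard {v : Fin n | p v} : ℕ) : ℝ) = ∑ v, if p v then (1 : ℝ) else 0 := by
  rw [Set.ncard_eq_toFinset_card', Set.toFinset_ofPred]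
  simp

open Classical in
theorem deg_eq_degree {n : ℕ} (G : SimpleGraph (Fin n)) (v : Fin n) : deg G v = G.degree v := by
  unfold deg
  rw [Set.ncard_eq_toFinset_card', ← SimpleGraph.card_neighborFinset_eq_degree]
  congr 1

open Classical in
theorem odd_deg_card_lt {n : ℕ} (hodd : Odd n) (G : SimpleGraph (Fin n)) :
    (Finset.univ.filter fun v => Odd (deg G v)).card + 1 ≤ n := by
  have h1 := G.even_card_odd_degree_vertices
  simp only [deg_eq_degree]
  have h2 := Finset.card_le_univ (Finset.univ.filter fun v => Odd (G.degree v))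
  rw [Fintype.card_fin] at h2
  have h3 : (Finset.univ.filter fun v => Odd (G.degree v)).card ≠ n := by
    intro h
    rw [h] at h1
    exact (Nat.not_even_iff_odd.mpr hodd) h1
  omega

/-- For odd `n`, every realizable dual degree partition `x` on `n` vertices satisfies
`(x_1 - x_2) + (x_3 - x_4) + ⋯ + (x_{n-2} - x_{n-1}) ≤ n - 1`. -/
theorem altSum_le_of_realizable (n : ℕ) (hn : 0 < n) (hodd : Odd n)
    (x : Fin (n - 1) → ℝ) (hx : IsRealizableDDP n x) :
    altSum n x ≤ (n : ℝ) - 1 := by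
  classical
  obtain ⟨G, rfl⟩ := hx
  have key : altSum n (ddp n G) = ∑ v : Fin n,
      if Odd (deg G v) ∧ deg G v < 2 * ((n - 1) / 2) then (1 : ℝ) else 0 := by
    simp_rw [← alt_indicator_sum]
    rw [Finset.sum_comm]
    unfold altSum
    refine Finset.sum_congr rfl fun i hi => ?_
    rw [Finset.mem_range] at hi
    rw [dif_pos (by omega), dif_pos (by omega), Finset.sum_sub_distrib]
    simp only [ddp]
    rw [ncard_eq_sum_ind, ncard_eq_sum_ind]
    congr!
  have h2 : altSum n (ddp n G) ≤ ∑ v : Fin n, if Odd (deg G v) then (1 : ℝ) else 0 := by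
    rw [key]
    refine Finset.sum_le_sum fun v _ => ?_
    split_ifs <;> first | tauto | norm_num
  have h3 := odd_deg_card_lt hodd G
  have h4 : ((Finset.univ.filter fun v => Odd (deg G v)).card : ℝ) + 1 ≤ n := by
    exact_mod_cast h3
  rw [Finset.sum_boole] at h2
  linarith
end

section
/- Let n be an odd positive integer and let R ⊆ ℝ^{n−1} be the polytope defined by n ≥ x_1 ≥ x_2 ≥ … ≥ x_{n−1} ≥ 0 and (x_1 − x_2) + (x_3 − x_4) + … + (x_{n−2} − x_{n−1}) ≤ n − 1. Then every extreme point of R is one of the points a^(k) (0 ≤ 2k ≤ n−1), b^(k,l) (k, l ≥ 0, 2k+2l ≤ n−3), or c^(k,l) (k, l ≥ 0, 2k+2l ≤ n−3), where a^(k) = (n,…,n,0,…,0) with 2k entries n and n−1−2k zeros; b^(k,l) = (n,…,n,n−1,…,n−1,0,…,0) with 2k entries n, then 2l+1 entries n−1, then n−2−2k−2l zeros; and c^(k,l) = (n,…,n,1,…,1,0,…,0) with 2k+1 entries n, then 2l+1 entries 1, then n−3−2k−2l zeros. -/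
/-- The point whose consecutive differences are given by `w`. -/
noncomputable def Lmap (n : ℕ) (w : ℕ → ℝ) : Fin (n - 1) → ℝ :=
  fun j => ∑ a ∈ Finset.Ico ((j : ℕ) + 1) n, w a

/-- Sum of the odd-indexed differences. -/
noncomputable def oddS (p : ℕ) (w : ℕ → ℝ) : ℝ := ∑ i ∈ Finset.range p, w (2 * i + 1)

lemma altSum_Lmap (p : ℕ) (w : ℕ → ℝ) :
    altSum (2 * p + 1) (Lmap (2 * p + 1) w) = oddS p w := by
  unfold altSum oddS
  have : (2 * p + 1 - 1) / 2 = p := by omega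
  rw [this]
  refine Finset.sum_congr rfl fun i hi => ?_
  have hi := Finset.mem_range.1 hi
  rw [dif_pos (by omega), dif_pos (by omega)]
  simp only [Lmap]
  rw [Finset.sum_eq_sum_Ico_succ_bot (by omega : 2 * i + 1 < 2 * p + 1)]
  ring

lemma Lmap_mem (n : ℕ) (w : ℕ → ℝ) (h0 : ∀ a < n, 0 ≤ w a)
    (hs : ∑ a ∈ Finset.range n, w a = n) : Lmap n w ∈ Rpoly n := by
  have hle : ∀ s t : Finset ℕ, s ⊆ t → t ⊆ Finset.range n → ∑ a ∈ s, w a ≤ ∑ a ∈ t, w a := by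
    intro s t hst ht
    exact Finset.sum_le_sum_of_subset_of_nonneg hst
      fun i hi _ => h0 i (Finset.mem_range.1 (ht hi))
  refine ⟨fun i => ?_, fun i => ?_, fun i j hij => ?_⟩
  · rw [← hs]
    refine hle _ _ ?_ (Finset.Subset.refl _)
    intro a; simp
  · exact Finset.sum_nonneg fun a ha => h0 a (Finset.mem_Ico.1 ha).2
  · refine hle _ _ ?_ ?_
    · intro a; have : (i : ℕ) ≤ j := hij
      simp only [Finset.mem_Ico]; omega
    · intro a; simp

lemma exists_Lmap (n : ℕ) (hn : 0 < n) (x : Fin (n - 1) → ℝ) (hx : x ∈ Rpoly n) :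
    ∃ w : ℕ → ℝ, (∀ a < n, 0 ≤ w a) ∧ ∑ a ∈ Finset.range n, w a = n ∧ x = Lmap n w := by
  obtain ⟨h1, h2, h3⟩ := hx
  -- tail function
  let X : ℕ → ℝ := fun a => if a = 0 then (n : ℝ) else if h : a - 1 < n - 1 then x ⟨a - 1, h⟩ else 0
  have hsum : ∀ k m, k ≤ m → ∑ a ∈ Finset.Ico k m, (X a - X (a + 1)) = X k - X m := by
    intro k m hkm
    induction m, hkm using Nat.le_induction with
    | base => simp
    | succ m hm ih => rw [Finset.sum_Ico_succ_top hm, ih]; ring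
  have hXn : X n = 0 := by
    simp only [X]; rw [if_neg (by omega), dif_neg (by omega)]
  have hX0 : X 0 = n := by simp [X]
  refine ⟨fun a => X a - X (a + 1), ?_, ?_, ?_⟩
  · intro a ha
    simp only [X, Nat.add_eq_zero_iff, one_ne_zero, and_false, if_false, Nat.add_sub_cancel,
      sub_nonneg]
    split_ifs with q1 q2 q3 q4
    · exact h1 _
    · exact h3 _ _ (by simp [Fin.le_def])
    · omega
    · positivity
    · exact h2 _
    · exact le_refl _
  · rw [Finset.range_eq_Ico, hsum 0 n (by omega), hXn, hX0, sub_zero]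
  · funext j
    simp only [Lmap]
    rw [hsum _ _ (by omega), hXn]
    simp [X]

lemma oddS_add (p : ℕ) (w d : ℕ → ℝ) (c : ℝ) :
    oddS p (fun a => w a + c * d a) = oddS p w + c * oddS p d := by
  simp [oddS, Finset.sum_add_distrib, Finset.mul_sum]

lemma Lmap_add (p : ℕ) (w d : ℕ → ℝ) (c : ℝ) :
    Lmap p (fun a => w a + c * d a) = Lmap p w + c • Lmap p d := by
  funext j
  simp [Lmap, Finset.sum_add_distrib, Finset.mul_sum]

/-- Indicator of a point. -/
noncomputable def ind (a : ℕ) : ℕ → ℝ := fun i => if i = a then 1 else 0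

lemma oddS_ind (p a : ℕ) (ha : a < 2 * p + 1) : oddS p (ind a) = if a % 2 = 1 then 1 else 0 := by
  unfold oddS ind
  split_ifs with h
  · obtain ⟨k, rfl⟩ : ∃ k, a = 2 * k + 1 := ⟨a / 2, by omega⟩
    rw [Finset.sum_eq_single k]
    · simp
    · intro b _ hb; rw [if_neg (by omega)]
    · intro hk; exact absurd (Finset.mem_range.2 (by omega)) hk
  · exact Finset.sum_eq_zero fun i _ => if_neg (by omega)

lemma perturb (p : ℕ) (w : ℕ → ℝ) (h0 : ∀ a < 2 * p + 1, 0 ≤ w a)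
    (hs : ∑ a ∈ Finset.range (2 * p + 1), w a = (2 * p + 1 : ℕ))
    (hx : Lmap (2 * p + 1) w ∈ Set.extremePoints ℝ
      (Rpoly (2 * p + 1) ∩ {x | altSum (2 * p + 1) x ≤ ((2 * p + 1 : ℕ) : ℝ) - 1}))
    (a b : ℕ) (hab : a < b) (hb : b < 2 * p + 1) (wa : 0 < w a) (wb : 0 < w b)
    (h : a % 2 = b % 2 ∨ oddS p w < ((2 * p + 1 : ℕ) : ℝ) - 1) : False := by
  set N : ℝ := ((2 * p + 1 : ℕ) : ℝ) with hN
  have hmem := hx.1.2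
  simp only [Set.mem_ofPred_eq, altSum_Lmap] at hmem
  let d : ℕ → ℝ := fun i => ind a i + (-1) * ind b i
  have hd : oddS p d = oddS p (ind a) + (-1) * oddS p (ind b) := oddS_add _ _ _ _
  rw [oddS_ind p a (by omega), oddS_ind p b hb] at hd
  obtain ⟨e, he, hea, heb, hec⟩ : ∃ e : ℝ, 0 < e ∧ e ≤ w a ∧ e ≤ w b ∧
      ∀ c, |c| ≤ e → oddS p w + c * oddS p d ≤ N - 1 := by
    rcases h with h | h
    · refine ⟨min (w a) (w b), lt_min wa wb, min_le_left _ _, min_le_right _ _, ?_⟩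
      intro c _
      rw [hd, h]; ring_nf; linarith
    · refine ⟨min (min (w a) (w b)) (N - 1 - oddS p w), lt_min (lt_min wa wb) (by linarith),
        (min_le_left _ _).trans (min_le_left _ _), (min_le_left _ _).trans (min_le_right _ _), ?_⟩
      intro c hc
      have h1 := abs_le.1 (hc.trans (min_le_right _ _))
      rw [hd]
      split_ifs <;> linarith [h1.1, h1.2]
  have key : ∀ c, |c| ≤ e → Lmap (2 * p + 1) (fun i => w i + c * d i) ∈
      (Rpoly (2 * p + 1) ∩ {x | altSum (2 * p + 1) x ≤ N - 1}) := by
    intro c hc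
    have hc' := abs_le.1 hc
    refine ⟨Lmap_mem _ _ ?_ ?_, ?_⟩
    · intro i hi
      have := h0 i hi
      simp only [d, ind]
      split_ifs with q1 q2 q2
      · omega
      · subst q1; linarith [hc'.1]
      · subst q2; linarith [hc'.2]
      · linarith
    · rw [Finset.sum_add_distrib, hs, ← Finset.mul_sum]
      have : ∑ i ∈ Finset.range (2 * p + 1), d i = 0 := by
        simp only [d, ind, Finset.sum_add_distrib, ← Finset.mul_sum, Finset.sum_ite_eq',
          Finset.mem_range]
        rw [if_pos (by omega), if_pos hb]; ring
      rw [this]; ring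
    · simp only [Set.mem_ofPred_eq, altSum_Lmap]
      rw [oddS_add p w d c]; exact hec c hc
  have k1 := key e (by rw [abs_of_pos he])
  have k2 := key (-e) (by rw [abs_neg, abs_of_pos he])
  have hE := hx.2 k1 k2 ?_
  · rw [Lmap_add _ w d e] at hE
    have h3 := congrFun hE ⟨a, by omega⟩
    have h4 : Lmap (2 * p + 1) d ⟨a, by omega⟩ = -1 := by
      simp only [Lmap, d, ind, Finset.sum_add_distrib, ← Finset.mul_sum, Finset.sum_ite_eq',
          Finset.mem_Ico]
      rw [if_neg (by omega), if_pos (by omega)]; ring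
    simp only [Pi.add_apply, Pi.smul_apply, smul_eq_mul, h4] at h3
    linarith
  · refine ⟨1 / 2, 1 / 2, by norm_num, by norm_num, by norm_num, ?_⟩
    rw [Lmap_add _ w d e, Lmap_add _ w d (-e)]
    funext j
    simp only [Pi.add_apply, Pi.smul_apply, smul_eq_mul]
    ring

lemma Lmap_two (n : ℕ) (s t : ℝ) (a b : ℕ) (ha : a < n) (hb : b < n) (w : ℕ → ℝ)
    (hw : ∀ i < n, w i = s * ind a i + t * ind b i) (j : Fin (n - 1)) :
    Lmap n w j = (if (j : ℕ) < a then s else 0) + (if (j : ℕ) < b then t else 0) := by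
  have : Lmap n w j = ∑ i ∈ Finset.Ico ((j : ℕ) + 1) n, (s * ind a i + t * ind b i) :=
    Finset.sum_congr rfl fun i hi => hw i (Finset.mem_Ico.1 hi).2
  rw [this]
  simp only [ind, Finset.sum_add_distrib, ← Finset.mul_sum, Finset.sum_ite_eq', Finset.mem_Ico]
  simp [ha, hb, Nat.succ_le_iff]

/-- For odd `n`, every extreme point of the polytope `{x : n ≥ x_1 ≥ ⋯ ≥ x_{n-1} ≥ 0,`
`(x_1-x_2)+⋯+(x_{n-2}-x_{n-1}) ≤ n-1}` is one of the points `a^(k)` (`0 ≤ 2k ≤ n-1`),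
`b^(k,l)` or `c^(k,l)` (`k, l ≥ 0`, `2k+2l ≤ n-3`). -/
theorem extremePoints_Rodd (n : ℕ) (hn : 0 < n) (hodd : Odd n) :
    ∀ x ∈ Set.extremePoints ℝ (Rpoly n ∩ {x | altSum n x ≤ (n : ℝ) - 1}),
      (∃ k : ℕ, 2 * k ≤ n - 1 ∧ x = aPoint n (2 * k)) ∨
      (∃ k l : ℕ, 2 * k + 2 * l + 3 ≤ n ∧ x = bPoint n k l) ∨
      (∃ k l : ℕ, 2 * k + 2 * l + 3 ≤ n ∧ x = cPoint n k l) := by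
  obtain ⟨p, rfl⟩ := hodd
  intro x hx
  obtain ⟨w, h0, hs, rfl⟩ := exists_Lmap _ hn x hx.1.1
  have hP := perturb p w h0 hs hx
  have hP' : ∀ a b, a ≠ b → a < 2 * p + 1 → b < 2 * p + 1 → 0 < w a → 0 < w b →
      (a % 2 = b % 2 ∨ oddS p w < ((2 * p + 1 : ℕ) : ℝ) - 1) → False := by
    intro a b hne ha hb wa wb h
    rcases lt_or_gt_of_ne hne with hlt | hlt
    · exact hP a b hlt hb wa wb h
    · exact hP b a hlt ha wb wa (h.imp Eq.symm id)
  have hmem := hx.1.2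
  simp only [Set.mem_ofPred_eq, altSum_Lmap] at hmem
  have hsplit : ∀ s t a b, a < 2 * p + 1 → b < 2 * p + 1 →
      (∀ i < 2 * p + 1, w i = s * ind a i + t * ind b i) →
      s + t = ((2 * p + 1 : ℕ) : ℝ) ∧
      oddS p w = s * (if a % 2 = 1 then 1 else 0) + t * (if b % 2 = 1 then 1 else 0) := by
    intro s t a b ha hb hw
    constructor
    · rw [← hs, Finset.sum_congr rfl fun i hi => hw i (Finset.mem_range.1 hi)]
      simp only [ind, Finset.sum_add_distrib, ← Finset.mul_sum, Finset.sum_ite_eq',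
        Finset.mem_range]
      simp [ha, hb]
    · rw [← oddS_ind p a ha, ← oddS_ind p b hb]
      simp only [oddS, Finset.mul_sum, ← Finset.sum_add_distrib]
      exact Finset.sum_congr rfl fun i hi => hw _ (by have := Finset.mem_range.1 hi; omega)
  have hz : ∀ i < 2 * p + 1, ¬ 0 < w i → w i = 0 := fun i hi h => le_antisymm (not_lt.1 h) (h0 i hi)
  by_cases hE : ∃ E < 2 * p + 1, E % 2 = 0 ∧ 0 < w E
  · obtain ⟨E, hEn, hE2, hEw⟩ := hE
    by_cases hO : ∃ O < 2 * p + 1, O % 2 = 1 ∧ 0 < w O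
    · obtain ⟨O, hOn, hO2, hOw⟩ := hO
      have hw : ∀ i < 2 * p + 1, w i = w E * ind E i + w O * ind O i := by
        intro i hi
        simp only [ind]
        split_ifs with q1 q2 q2
        · omega
        · subst q1; ring
        · subst q2; ring
        · rw [hz i hi]
          · ring
          · intro hpos
            rcases Nat.mod_two_eq_zero_or_one i with h | h
            · exact hP' i E q1 hi hEn hpos hEw (Or.inl (by omega))
            · exact hP' i O q2 hi hOn hpos hOw (Or.inl (by omega))
      obtain ⟨e1, e2⟩ := hsplit _ _ _ _ hEn hOn hw
      rw [if_neg (by omega), if_pos hO2] at e2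
      have e3 : oddS p w = ((2 * p + 1 : ℕ) : ℝ) - 1 := by
        by_contra hne
        exact hP' E O (by omega) hEn hOn hEw hOw (Or.inr (lt_of_le_of_ne hmem hne))
      have eO : w O = ((2 * p + 1 : ℕ) : ℝ) - 1 := by linarith
      have eE : w E = 1 := by linarith
      right
      rcases lt_or_ge E O with hlt | hlt
      · left
        refine ⟨E / 2, (O - E) / 2, by omega, ?_⟩
        funext j
        rw [Lmap_two _ _ _ _ _ hEn hOn w hw, eO, eE]
        simp only [bPoint]
        have q1 : 2 * (E / 2) = E := by omega
        have q2 : E + 2 * ((O - E) / 2) + 1 = O := by omega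
        rw [q1, q2]
        split_ifs <;> first | omega | ring
      · right
        refine ⟨O / 2, (E - O) / 2, by omega, ?_⟩
        funext j
        rw [Lmap_two _ _ _ _ _ hEn hOn w hw, eO, eE]
        simp only [cPoint]
        have q1 : 2 * (O / 2) + 1 = O := by omega
        have q2 : 2 * (O / 2) + 2 * ((E - O) / 2) + 2 = E := by omega
        rw [q1, q2]
        split_ifs <;> first | omega | ring
    · have hw : ∀ i < 2 * p + 1, w i = w E * ind E i + 0 * ind E i := by
        intro i hi
        simp only [ind]
        split_ifs with q1
        · subst q1; ring
        · rw [hz i hi]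
          · ring
          · intro hpos
            rcases Nat.mod_two_eq_zero_or_one i with h | h
            · exact hP' i E q1 hi hEn hpos hEw (Or.inl (by omega))
            · exact hO ⟨i, hi, h, hpos⟩
      obtain ⟨e1, e2⟩ := hsplit _ _ _ _ hEn hEn hw
      left
      refine ⟨E / 2, by omega, ?_⟩
      funext j
      rw [Lmap_two _ _ _ _ _ hEn hEn w hw]
      simp only [aPoint]
      have q1 : 2 * (E / 2) = E := by omega
      rw [q1, ← e1]
      split_ifs <;> ring
  · exfalso
    have hall : ∀ i < 2 * p + 1, i % 2 = 0 → w i = 0 :=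
      fun i hi h => hz i hi fun hpos => hE ⟨i, hi, h, hpos⟩
    by_cases hO : ∃ O < 2 * p + 1, O % 2 = 1 ∧ 0 < w O
    · obtain ⟨O, hOn, hO2, hOw⟩ := hO
      have hw : ∀ i < 2 * p + 1, w i = w O * ind O i + 0 * ind O i := by
        intro i hi
        simp only [ind]
        split_ifs with q1
        · subst q1; ring
        · rw [hz i hi]
          · ring
          · intro hpos
            rcases Nat.mod_two_eq_zero_or_one i with h | h
            · exact hE ⟨i, hi, h, hpos⟩
            · exact hP' i O q1 hi hOn hpos hOw (Or.inl (by omega))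
      obtain ⟨e1, e2⟩ := hsplit _ _ _ _ hOn hOn hw
      rw [if_pos hO2] at e2
      linarith
    · have : ∑ a ∈ Finset.range (2 * p + 1), w a = 0 := by
        refine Finset.sum_eq_zero fun i hi => hz i (Finset.mem_range.1 hi) fun hpos => ?_
        rcases Nat.mod_two_eq_zero_or_one i with h | h
        · exact hE ⟨i, Finset.mem_range.1 hi, h, hpos⟩
        · exact hO ⟨i, Finset.mem_range.1 hi, h, hpos⟩
      rw [this] at hs
      have : (0 : ℝ) < ((2 * p + 1 : ℕ) : ℝ) := by exact_mod_cast hn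
      linarith
end

section
/- Let n be an odd positive integer. The n points consisting of a^(k) for 0 ≤ 2k ≤ n−1 together with b^(0,l) for 0 ≤ 2l ≤ n−3 are affinely independent in ℝ^{n−1}, where a^(k) = (n,…,n,0,…,0) with 2k entries n and n−1−2k zeros, and b^(0,l) = (n−1,…,n−1,0,…,0) with 2l+1 entries n−1 and n−2−2l zeros. Consequently the convex hull of all realizable dual degree partitions on n vertices is a full-dimensional subset of ℝ^{n−1}. -/
lemma point_apply (n : ℕ) (i : Fin n) (j : Fin (n - 1)) :
    (if (i : ℕ) % 2 = 0 then aPoint n (i : ℕ) else bPoint n 0 ((i : ℕ) / 2)) j =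
      if (j : ℕ) < (i : ℕ) then (if (i : ℕ) % 2 = 0 then (n : ℝ) else (n : ℝ) - 1) else 0 := by
  by_cases h : (i : ℕ) % 2 = 0
  · simp [h, aPoint]
  · have : 2 * ((i : ℕ) / 2) + 1 = i := by omega
    simp [h, bPoint, this]

lemma affInd (n : ℕ) : AffineIndependent ℝ (fun i : Fin n =>
      if (i : ℕ) % 2 = 0 then aPoint n (i : ℕ) else bPoint n 0 ((i : ℕ) / 2)) := by
  rw [affineIndependent_iff]
  intro s w hw hp
  have hc : ∀ m : ℕ, 1 ≤ m → ∑ i ∈ s, (if m ≤ (i : ℕ) then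
      w i * (if (i : ℕ) % 2 = 0 then (n : ℝ) else (n : ℝ) - 1) else 0) = 0 := by
    intro m hm
    by_cases hmn : m < n
    · have := congrFun hp ⟨m - 1, by omega⟩
      rw [Finset.sum_apply] at this
      simp only [Pi.smul_apply, point_apply, smul_eq_mul, Pi.zero_apply, mul_ite, mul_zero] at this
      refine Eq.trans ?_ this
      refine Finset.sum_congr rfl fun i _ => ?_
      have : (m ≤ (i : ℕ)) ↔ m - 1 < (i : ℕ) := by omega
      simp only [this, mul_ite]
    · refine Finset.sum_eq_zero fun i _ => ?_
      rw [if_neg]; have := i.2; omega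
  have hpos : ∀ e ∈ s, 1 ≤ (e : ℕ) → w e = 0 := by
    intro e he h1
    have h := congrArg₂ (· - ·) (hc e h1) (hc (e + 1) (by omega))
    simp only [← Finset.sum_sub_distrib, sub_zero] at h
    rw [Finset.sum_eq_single_of_mem e he] at h
    · simp only [le_refl, if_true] at h
      rw [if_neg (Nat.not_succ_le_self (e : ℕ)), sub_zero] at h
      have hn : (2 : ℝ) ≤ n := by exact_mod_cast (by omega : 2 ≤ n)
      rcases mul_eq_zero.1 h with h | h
      · exact h
      · split_ifs at h <;> linarith
    · intro b _ hb
      have hb' : (b : ℕ) ≠ e := fun h => hb (Fin.ext h)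
      have : ((e : ℕ) ≤ b) ↔ (e : ℕ) + 1 ≤ b := by omega
      simp only [this, sub_self]
  intro e he
  by_cases h1 : 1 ≤ (e : ℕ)
  · exact hpos e he h1
  · rw [Finset.sum_eq_single_of_mem e he] at hw
    · exact hw
    · intro b hb hbe
      have hb' : (b : ℕ) ≠ e := fun h => hbe (Fin.ext h)
      exact hpos b hb (by omega)

/-- The star with centre `0` and leaves `1, …, k`. -/
def starG (n k : ℕ) : SimpleGraph (Fin n) where
  Adj v w := ((v : ℕ) = 0 ∧ 1 ≤ (w : ℕ) ∧ (w : ℕ) ≤ k) ∨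
    ((w : ℕ) = 0 ∧ 1 ≤ (v : ℕ) ∧ (v : ℕ) ≤ k)
  symm := ⟨fun _ _ h => h.symm⟩
  loopless := ⟨fun v h => by omega⟩

lemma ncard_Icc (n a k : ℕ) (hk : k < n) :
    Set.ncard {w : Fin n | a ≤ (w : ℕ) ∧ (w : ℕ) ≤ k} = k + 1 - a := by
  rw [← Set.ncard_image_of_injective _ Fin.val_injective]
  have : Fin.val '' {w : Fin n | a ≤ (w : ℕ) ∧ (w : ℕ) ≤ k} = ↑(Finset.Icc a k) := by
    ext x
    simp only [Set.mem_image, Set.mem_ofPred_eq, Finset.coe_Icc, Set.mem_Icc]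
    constructor
    · rintro ⟨w, h, rfl⟩; exact h
    · intro h; exact ⟨⟨x, by omega⟩, h, rfl⟩
  rw [this, Set.ncard_coe_finset, Nat.card_Icc]

lemma deg_star (n k : ℕ) (hk : k < n) (v : Fin n) :
    deg (starG n k) v = if (v : ℕ) = 0 then k else if (v : ℕ) ≤ k then 1 else 0 := by
  unfold deg
  split_ifs with h0 h1
  · refine Eq.trans ?_ (ncard_Icc n 1 k hk)
    congr 1; ext w; simp only [starG, Set.mem_ofPred_eq]; omega
  · rw [Set.ncard_eq_one]
    refine ⟨⟨0, by omega⟩, ?_⟩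
    ext w; simp only [starG, Set.mem_ofPred_eq, Set.mem_singleton_iff, Fin.ext_iff]; omega
  · rw [Set.ncard_eq_zero]
    refine Set.eq_empty_of_forall_notMem fun w => ?_
    simp only [starG, Set.mem_ofPred_eq]; omega

lemma ddp_star (n k : ℕ) (hk : k < n) (j : Fin (n - 1)) :
    ddp n (starG n k) j = if (j : ℕ) < k then (if (j : ℕ) = 0 then (k : ℝ) + 1 else 1) else 0 := by
  unfold ddp
  simp only [deg_star n k hk]
  have key : ∀ c : ℕ, c ≤ k → {v : Fin n | (j : ℕ) + 1 ≤
      if (v : ℕ) = 0 then k else if (v : ℕ) ≤ k then 1 else 0} =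
      {w : Fin n | 0 ≤ (w : ℕ) ∧ (w : ℕ) ≤ c} →
      Set.ncard {v : Fin n | (j : ℕ) + 1 ≤
      if (v : ℕ) = 0 then k else if (v : ℕ) ≤ k then 1 else 0} = c + 1 := by
    intro c hc h
    rw [h, ncard_Icc n 0 c (by omega)]; rfl
  split_ifs with h1 h2
  · rw [key k le_rfl]
    · push_cast; rfl
    · ext v; simp only [Set.mem_ofPred_eq]; split_ifs <;> omega
  · rw [key 0 (by omega)]
    · simp
    · ext v; simp only [Set.mem_ofPred_eq]; split_ifs <;> omega
  · norm_cast
    rw [Set.ncard_eq_zero]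
    refine Set.eq_empty_of_forall_notMem fun v => ?_
    simp only [Set.mem_ofPred_eq]; split_ifs <;> omega

lemma fullDim (n : ℕ) (hn : 0 < n) :
    affineSpan ℝ (convexHull ℝ {x : Fin (n - 1) → ℝ | IsRealizableDDP n x}) = ⊤ := by
  rw [affineSpan_convexHull]
  have hne : {x : Fin (n - 1) → ℝ | IsRealizableDDP n x}.Nonempty := ⟨_, starG n 0, rfl⟩
  rw [AffineSubspace.affineSpan_eq_top_iff_vectorSpan_eq_top_of_nonempty _ _ _ hne]
  rw [eq_top_iff, ← (Pi.basisFun ℝ (Fin (n - 1))).span_eq, Submodule.span_le]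
  have hd : ∀ k l : ℕ, ddp n (starG n k) - ddp n (starG n l) ∈
      vectorSpan ℝ {x : Fin (n - 1) → ℝ | IsRealizableDDP n x} := fun k l =>
    vsub_mem_vectorSpan ℝ ⟨_, rfl⟩ ⟨_, rfl⟩
  rintro _ ⟨j, rfl⟩
  have hj := j.2
  have h0 : (Pi.single (⟨0, by omega⟩ : Fin (n - 1)) (1 : ℝ) : Fin (n - 1) → ℝ) ∈
      vectorSpan ℝ {x : Fin (n - 1) → ℝ | IsRealizableDDP n x} := by
    convert Submodule.smul_mem _ (1 / 2 : ℝ) (hd 1 0) using 1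
    ext i
    simp only [Pi.smul_apply, Pi.sub_apply, ddp_star n 1 (by omega), ddp_star n 0 hn,
      Pi.single_apply, Fin.ext_iff, smul_eq_mul]
    by_cases hi : (i : ℕ) = 0
    · simp [hi]; norm_num
    · simp [hi]
  rw [Pi.basisFun_apply, SetLike.mem_coe]
  by_cases hj0 : (j : ℕ) = 0
  · have hje : j = ⟨0, by omega⟩ := Fin.ext hj0
    rw [hje]; exact h0
  · convert Submodule.sub_mem _ (hd (j + 1) j) h0 using 1
    ext i
    simp only [Pi.sub_apply, ddp_star n (j + 1) (by omega), ddp_star n j (by omega),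
      Pi.single_apply, Fin.ext_iff]
    push_cast
    split_ifs <;> first | omega | ring

/-- For odd `n`, the `n` points `a^(k)` (`0 ≤ 2k ≤ n-1`, at even indices `2k`) together
with `b^(0,l)` (`0 ≤ 2l ≤ n-3`, at odd indices `2l+1`) are affinely independent in
`ℝ^{n-1}`; consequently the convex hull of all realizable dual degree partitions on
`n` vertices is full-dimensional. -/
theorem affineIndependent_and_fullDim (n : ℕ) (hn : 0 < n) (hodd : Odd n) :
    AffineIndependent ℝ (fun i : Fin n =>
      if (i : ℕ) % 2 = 0 then aPoint n (i : ℕ) else bPoint n 0 ((i : ℕ) / 2)) ∧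
    affineSpan ℝ (convexHull ℝ {x : Fin (n - 1) → ℝ | IsRealizableDDP n x}) = ⊤ := by
  exact ⟨affInd n, fullDim n hn⟩
end

section
/- For n = 7, the integral point x = (5, 3, 3, 3, 3, 3) ∈ ℝ^6 satisfies 7 ≥ x_1 ≥ x_2 ≥ … ≥ x_6 ≥ 0 and (x_1 − x_2) + (x_3 − x_4) + (x_5 − x_6) ≤ 6, has even component sum, yet it is not a realizable dual degree partition on 7 vertices. -/
/-- For `n = 7`, the point `x = (5,3,3,3,3,3)` satisfies `7 ≥ x_1 ≥ ⋯ ≥ x_6 ≥ 0` and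
`(x_1-x_2)+(x_3-x_4)+(x_5-x_6) ≤ 6`, has even component sum, but is not a realizable
dual degree partition on `7` vertices. -/
theorem not_realizable_example :
    (∀ i, (![5, 3, 3, 3, 3, 3] : Fin 6 → ℝ) i ≤ 7) ∧
    (∀ i, 0 ≤ (![5, 3, 3, 3, 3, 3] : Fin 6 → ℝ) i) ∧
    (∀ i j : Fin 6, i ≤ j →
      (![5, 3, 3, 3, 3, 3] : Fin 6 → ℝ) j ≤ (![5, 3, 3, 3, 3, 3] : Fin 6 → ℝ) i) ∧
    altSum 7 ![5, 3, 3, 3, 3, 3] ≤ 6 ∧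
    (∃ m : ℤ, ∑ i, (![5, 3, 3, 3, 3, 3] : Fin 6 → ℝ) i = 2 * m) ∧
    ¬ IsRealizableDDP 7 ![5, 3, 3, 3, 3, 3] := by
  refine ⟨?_, ?_, ?_, ?_, ⟨10, ?_⟩, ?_⟩
  · intro i; fin_cases i <;> norm_num
  · intro i; fin_cases i <;> norm_num
  · intro i j h
    fin_cases i <;> fin_cases j <;> first | (exfalso; revert h; decide) | norm_num
  · have h : altSum 7 ![5, 3, 3, 3, 3, 3] = (5 - 3) + (3 - 3) + (3 - 3) := by
      unfold altSum
      rw [show (7 - 1) / 2 = 3 from rfl]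
      simp only [Finset.sum_range_succ, Finset.sum_range_zero, zero_add]
      rfl
    rw [h]; norm_num
  · simp [Fin.sum_univ_succ]; norm_num
  · rintro ⟨G, hG⟩
    have h0 := congrFun hG (0 : Fin 6)
    have h5 := congrFun hG (5 : Fin 6)
    have e0 : (5 : ℝ) = (Set.ncard {v : Fin 7 | 0 + 1 ≤ deg G v} : ℝ) := h0
    have e5 : (3 : ℝ) = (Set.ncard {v : Fin 7 | 5 + 1 ≤ deg G v} : ℝ) := h5
    have n0 : 5 = Set.ncard {v : Fin 7 | 0 + 1 ≤ deg G v} := by exact_mod_cast e0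
    have n5 : 3 = Set.ncard {v : Fin 7 | 5 + 1 ≤ deg G v} := by exact_mod_cast e5
    obtain ⟨v, hv⟩ := Set.nonempty_of_ncard_ne_zero (by omega :
      Set.ncard {v : Fin 7 | 5 + 1 ≤ deg G v} ≠ 0)
    have hv' : 6 ≤ Set.ncard {w | G.Adj v w} := hv
    have hsub : {w | G.Adj v w} ⊆ ({v}ᶜ : Set (Fin 7)) := by
      intro w hw
      exact (G.ne_of_adj hw).symm
    have hc : Set.ncard ({v}ᶜ : Set (Fin 7)) = 6 := by
      rw [Set.ncard_compl]; simp
    have heq := Set.eq_of_subset_of_ncard_le hsub (by omega) (Set.toFinite _)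
    have hall : {v : Fin 7 | 0 + 1 ≤ deg G v} = Set.univ := by
      refine Set.eq_univ_of_forall fun w => ?_
      by_cases hw : w = v
      · subst hw
        exact le_trans (by norm_num) hv'
      · have hadj : w ∈ {w | G.Adj v w} := by rw [heq]; exact hw
        exact (Set.ncard_pos (Set.toFinite _)).2 ⟨v, G.adj_symm hadj⟩
    rw [hall, Set.ncard_univ] at n0
    simp at n0
end
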